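/- Assume (A2), (A3) and the normalization ψ(ξ) = 1 for |ξ| = 1. With p_t^s(x) = (2π)^{-d} ∫_{ℝ^d} e^{-iξ·x} e^{-t ψ^s(ξ)} dξ (where ψ^s(ξ) = s·ψ(ψ^{-1}(1/s)ξ)) and p_t^α(x) = (2π)^{-d} ∫_{ℝ^d} e^{-iξ·x − t|ξ|^α} dξ, one has, for every t > 0: lim_{s→∞} ∫_{ℝ^d} |p_t^s(x) − p_t^α(x)| dx = 0. In particular, for every Borel A ⊂ ℝ^d, ∫_A p_t^s(x) dx → ∫_A p_t^α(x) dx as s → ∞. -/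

import Mathlib

open MeasureTheory Filter Real
open scoped RealInnerProductSpace

noncomputable section

/-- Pruitt's concentration function `K(r) = r⁻² ∫_{|z|<r} |z|² ν(|z|) dz`. -/
def K (d : ℕ) (ν : ℝ → ℝ) (r : ℝ) : ℝ :=
  (∫ z in Metric.ball (0 : EuclideanSpace ℝ (Fin d)) r, ‖z‖ ^ 2 * ν ‖z‖) / r ^ 2

/-- Pruitt's concentration function `h(r) = ∫ (|z|²/r² ∧ 1) ν(|z|) dz`. -/
def hfun (d : ℕ) (ν : ℝ → ℝ) (r : ℝ) : ℝ :=
  ∫ z : EuclideanSpace ℝ (Fin d), min (‖z‖ ^ 2 / r ^ 2) 1 * ν ‖z‖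

/-- The characteristic (Lévy–Khintchine) exponent `ψ(ξ) = ∫ (1 - cos⟪ξ,z⟫) ν(|z|) dz`. -/
def ψ (d : ℕ) (ν : ℝ → ℝ) (ξ : EuclideanSpace ℝ (Fin d)) : ℝ :=
  ∫ z : EuclideanSpace ℝ (Fin d), (1 - Real.cos ⟪ξ, z⟫) * ν ‖z‖

/-- The radial nondecreasing majorant `ψ*(r) = sup_{|z| ≤ r} ψ(z)`. -/
def ψstar (d : ℕ) (ν : ℝ → ℝ) (r : ℝ) : ℝ :=
  sSup {y : ℝ | ∃ z : EuclideanSpace ℝ (Fin d), ‖z‖ ≤ r ∧ ψ d ν z = y}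

/-- The generalized inverse `ψ⁻¹(u) = sup {r ≥ 0 : ψ*(r) = u}`. -/
def ψinv (d : ℕ) (ν : ℝ → ℝ) (u : ℝ) : ℝ :=
  sSup {r : ℝ | 0 ≤ r ∧ ψstar d ν r = u}

/-- Characteristic exponent `ψˢ(ξ) = s·ψ(ψ⁻¹(1/s)ξ)` of the rescaled process. -/
def ψs (d : ℕ) (ν : ℝ → ℝ) (s : ℝ) (ξ : EuclideanSpace ℝ (Fin d)) : ℝ :=
  s * ψ d ν (ψinv d ν (1 / s) • ξ)

/-- Lévy density `νˢ(x) = s·ψ⁻¹(1/s)^{-d}·ν(x/ψ⁻¹(1/s))` of the rescaled process. -/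
def νs (d : ℕ) (ν : ℝ → ℝ) (s : ℝ) (x : EuclideanSpace ℝ (Fin d)) : ℝ :=
  s / ψinv d ν (1 / s) ^ d * ν (‖x‖ / ψinv d ν (1 / s))

/-- `ψ^{-1,s}(u) = ψ⁻¹(u/s)/ψ⁻¹(1/s)`. -/
def ψinvs (d : ℕ) (ν : ℝ → ℝ) (s u : ℝ) : ℝ :=
  ψinv d ν (u / s) / ψinv d ν (1 / s)

/-- The stable constant `𝒜(d,α)`. -/
def Aconst (d : ℕ) (α : ℝ) : ℝ :=
  α * (2 : ℝ) ^ (α - 1) * Real.Gamma (((d : ℝ) + α) / 2) /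
    (Real.Gamma (1 - α / 2) * Real.pi ^ ((d : ℝ) / 2))

/-- Heat kernel of the rescaled process, via Fourier inversion. -/
def pts (d : ℕ) (ν : ℝ → ℝ) (s t : ℝ) (x : EuclideanSpace ℝ (Fin d)) : ℝ :=
  ((2 * Real.pi) ^ d)⁻¹ *
    ∫ ξ : EuclideanSpace ℝ (Fin d), Real.cos ⟪ξ, x⟫ * Real.exp (-(t * ψs d ν s ξ))

/-- Heat kernel of the isotropic α-stable process. -/
def ptα (d : ℕ) (α t : ℝ) (x : EuclideanSpace ℝ (Fin d)) : ℝ :=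
  ((2 * Real.pi) ^ d)⁻¹ *
    ∫ ξ : EuclideanSpace ℝ (Fin d), Real.cos ⟪ξ, x⟫ * Real.exp (-(t * ‖ξ‖ ^ α))

/-- Heat kernel of the original process, via Fourier inversion. -/
def pt (d : ℕ) (ν : ℝ → ℝ) (t : ℝ) (x : EuclideanSpace ℝ (Fin d)) : ℝ :=
  ((2 * Real.pi) ^ d)⁻¹ *
    ∫ ξ : EuclideanSpace ℝ (Fin d), Real.cos ⟪ξ, x⟫ * Real.exp (-(t * ψ d ν ξ))

open scoped Topology FourierTransform

section Fourier

variable {V : Type*} [NormedAddCommGroup V] [InnerProductSpace ℝ V] [FiniteDimensional ℝ V]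
  [MeasurableSpace V] [BorelSpace V]

/-- The cosine transform of a real function. -/
def cosTransform (f : V → ℝ) (x : V) : ℝ := ∫ ξ, Real.cos ⟪ξ, x⟫ * f ξ

lemma integrable_cos_inner_mul {f : V → ℝ} (hf : Integrable f) (x : V) :
    Integrable (fun ξ => Real.cos ⟪ξ, x⟫ * f ξ) :=
  hf.bdd_mul (c := 1) (Continuous.aestronglyMeasurable (by fun_prop))
    (Eventually.of_forall fun ξ => by simpa using Real.abs_cos_le_one _)

lemma integrable_sin_inner_mul {f : V → ℝ} (hf : Integrable f) (x : V) :
    Integrable (fun ξ => Real.sin ⟪ξ, x⟫ * f ξ) :=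
  hf.bdd_mul (c := 1) (Continuous.aestronglyMeasurable (by fun_prop))
    (Eventually.of_forall fun ξ => by simpa using Real.abs_sin_le_one _)

lemma continuous_cosTransform {f : V → ℝ} (hf : Integrable f) : Continuous (cosTransform f) := by
  refine continuous_of_dominated (bound := fun ξ => ‖f ξ‖)
    (fun x => (integrable_cos_inner_mul hf x).aestronglyMeasurable) (fun x => ?_) hf.norm ?_
  · refine Eventually.of_forall fun ξ => ?_
    rw [norm_mul]
    exact mul_le_of_le_one_left (norm_nonneg _) (by simpa using Real.abs_cos_le_one _)
  · exact Eventually.of_forall fun ξ => by fun_prop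

lemma abs_cosTransform_sub_le {f g : V → ℝ} (hf : Integrable f) (hg : Integrable g) (x : V) :
    |cosTransform f x - cosTransform g x| ≤ ∫ ξ, |f ξ - g ξ| := by
  unfold cosTransform
  rw [← integral_sub (integrable_cos_inner_mul hf x) (integrable_cos_inner_mul hg x)]
  refine (abs_integral_le_integral_abs).trans (integral_mono ?_ ?_ fun ξ => ?_)
  · exact ((integrable_cos_inner_mul hf x).sub (integrable_cos_inner_mul hg x)).abs
  · exact (hf.sub hg).abs
  · simp only
    rw [← mul_sub, abs_mul]
    exact mul_le_of_le_one_left (abs_nonneg _) (Real.abs_cos_le_one _)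

lemma ofReal_cosTransform {f : V → ℝ} (hf : Integrable f) (heven : ∀ x, f (-x) = f x) (x : V) :
    (cosTransform f x : ℂ) = 𝓕 (fun v => (f v : ℂ)) ((2 * π)⁻¹ • x) := by
  have hsin : ∫ ξ, Real.sin ⟪ξ, x⟫ * f ξ = 0 := by
    have h := integral_neg_eq_self (fun ξ => Real.sin ⟪ξ, x⟫ * f ξ) volume
    simp only [inner_neg_left, Real.sin_neg, heven, neg_mul, integral_neg] at h
    linarith
  have hpt : ∀ v : V, Complex.exp ((↑(-2 * π * ⟪v, (2 * π)⁻¹ • x⟫) * Complex.I)) • (f v : ℂ)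
      = ((Real.cos ⟪v, x⟫ * f v : ℝ) : ℂ) - ((Real.sin ⟪v, x⟫ * f v : ℝ) : ℂ) * Complex.I := by
    intro v
    have : -2 * π * ⟪v, (2 * π)⁻¹ • x⟫ = - ⟪v, x⟫ := by
      rw [inner_smul_right]; field_simp
    rw [this, Complex.exp_mul_I, ← Complex.ofReal_cos, ← Complex.ofReal_sin, Real.cos_neg,
      Real.sin_neg, smul_eq_mul]
    push_cast
    ring
  rw [Real.fourier_eq']
  simp_rw [hpt]
  rw [integral_sub (integrable_cos_inner_mul hf x).ofReal
    ((integrable_sin_inner_mul hf x).ofReal.mul_const _), integral_mul_const,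
    integral_complex_ofReal, integral_complex_ofReal, hsin]
  simp [cosTransform]

lemma tendsto_integral_gaussian_mul_fourier {f : V → ℂ} (hf : Integrable f)
    (hf0 : ContinuousAt f 0) :
    Tendsto (fun c : ℝ => ∫ w : V, Complex.exp (-(c⁻¹ : ℂ) * ‖w‖ ^ 2) • (𝓕 f) w) atTop (𝓝 (f 0)) := by
  refine (Real.tendsto_integral_gaussian_smul' hf hf0).congr' ?_
  filter_upwards [Ioi_mem_atTop 0] with c (hc : 0 < c)
  have J : Integrable (fun w : V => Complex.exp (-(c⁻¹ : ℂ) * ‖w‖ ^ 2)) := by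
    simpa using GaussianFourier.integrable_cexp_neg_mul_sq_norm_add (V := V)
      (b := (c⁻¹ : ℂ)) (by simpa) 0 0
  have key : ∫ w : V, Complex.exp (-(c⁻¹ : ℂ) * ‖w‖ ^ 2) • (𝓕 f) w =
      ∫ w : V, 𝓕 (fun w : V => Complex.exp (-(c⁻¹ : ℂ) * ‖w‖ ^ 2)) w • f w := by
    simpa using! (VectorFourier.integral_fourierIntegral_smul_eq_flip (L := innerₗ V)
      Real.continuous_fourierChar continuous_inner J hf).symm
  rw [key]
  congr with w
  rw [fourier_gaussian_innerProductSpace (by simpa), zero_sub, norm_neg, div_inv_eq_mul,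
    div_inv_eq_mul, mul_right_comm]

lemma integrable_gaussian {b : ℝ} (hb : 0 < b) :
    Integrable (fun ξ : V => Real.exp (-b * ‖ξ‖ ^ 2)) := by
  have J := GaussianFourier.integrable_cexp_neg_mul_sq_norm_add (V := V)
      (b := (b : ℂ)) (by simpa using hb) 0 0
  refine J.norm.congr (Eventually.of_forall fun w => ?_)
  simp only [zero_mul, add_zero, Complex.norm_exp]
  congr 1
  norm_cast

/-- A nonnegative cosine transform of an even integrable continuous function is integrable, and
its integral is given by Fourier inversion at the origin. -/
theorem integrable_cosTransform {f : V → ℝ} (hf : Integrable f) (hc : Continuous f)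
    (heven : ∀ x, f (-x) = f x) (hpos : ∀ x, 0 ≤ cosTransform f x) :
    Integrable (cosTransform f) ∧
      ∫ x, cosTransform f x = (2 * π) ^ Module.finrank ℝ V * f 0 := by
  have hpi : (2 * π) ≠ 0 := by positivity
  set F : V → ℂ := fun v => (f v : ℂ) with hF
  have hFint : Integrable F := hf.ofReal
  have hFc : Continuous F := by fun_prop
  have hcos : ∀ w, (cosTransform f ((2 * π) • w) : ℂ) = 𝓕 F w := fun w => by
    rw [ofReal_cosTransform hf heven, smul_smul, inv_mul_cancel₀ hpi, one_smul]
  have hcc : Continuous (cosTransform f) := continuous_cosTransform hf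
  set p : V → ℝ := fun w => cosTransform f ((2 * π) • w) with hp
  have hpc : Continuous p := by fun_prop
  have hpint : Integrable p := by
    set G : ℕ → V → ℝ := fun n w => Real.exp (-(n : ℝ)⁻¹ * ‖w‖ ^ 2) * p w with hG
    have hG0 : ∀ n w, 0 ≤ G n w := fun n w => mul_nonneg (Real.exp_pos _).le (hpos _)
    have hGm : ∀ n, AEStronglyMeasurable (G n) volume := fun n =>
      Continuous.aestronglyMeasurable (by fun_prop)
    have hGp : ∀ᵐ w, Tendsto (fun n => G n w) atTop (𝓝 (p w)) := by
      refine Eventually.of_forall fun w => ?_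
      have h1 : Tendsto (fun n : ℕ => -(n : ℝ)⁻¹ * ‖w‖ ^ 2) atTop (𝓝 (-0 * ‖w‖ ^ 2)) :=
        (tendsto_inv_atTop_nhds_zero_nat.neg).mul_const _
      have h2 := ((Real.continuous_exp.tendsto _).comp h1).mul_const (p w)
      simpa [hG] using h2
    have hlim : Tendsto (fun n : ℕ => ∫ w, G n w) atTop (𝓝 (f 0)) := by
      have h := (Complex.continuous_re.tendsto _).comp
        ((tendsto_integral_gaussian_mul_fourier hFint hFc.continuousAt).comp
          tendsto_natCast_atTop_atTop)
      refine (h.congr fun n => ?_)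
      have : ∀ w, Complex.exp (-((n : ℝ) : ℂ)⁻¹ * ‖w‖ ^ 2) • (𝓕 F) w = ((G n w : ℝ) : ℂ) := by
        intro w
        rw [← hcos w]
        simp [hG, hp]
      simp only [Function.comp_apply, this]
      rw [integral_complex_ofReal, Complex.ofReal_re]
    have hGint : ∀ᶠ n : ℕ in atTop, Integrable (G n) := by
      filter_upwards [eventually_gt_atTop 0] with n hn
      have hn' : (0 : ℝ) < (n : ℝ)⁻¹ := by positivity
      have J' := integrable_gaussian (V := V) hn'
      refine J'.mul_bdd (c := ∫ ξ, |f ξ|) hpc.aestronglyMeasurable (Eventually.of_forall fun w => ?_)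
      have h := abs_cosTransform_sub_le hf (integrable_zero V ℝ volume) ((2 * π) • w)
      simpa [cosTransform, hp] using h
    refine ⟨hpc.aestronglyMeasurable, ?_⟩
    have hfatou : ∫⁻ w, ‖p w‖ₑ ≤ liminf (fun n => ∫⁻ w, ‖G n w‖ₑ) atTop := by
      refine le_trans (le_of_eq (lintegral_congr_ae ?_))
        (lintegral_liminf_le' fun n => (hGm n).aemeasurable.enorm)
      filter_upwards [hGp] with w hw using hw.enorm.liminf_eq.symm
    refine lt_of_le_of_lt hfatou ?_
    have hl : Tendsto (fun n => ∫⁻ w, ‖G n w‖ₑ) atTop (𝓝 (ENNReal.ofReal (f 0))) := by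
      refine (ENNReal.tendsto_ofReal hlim).congr' ?_
      filter_upwards [hGint] with n hn
      rw [ofReal_integral_eq_lintegral_ofReal hn (Eventually.of_forall (hG0 n))]
      refine lintegral_congr fun w => ?_
      rw [Real.enorm_eq_ofReal (hG0 n w)]
    rw [hl.liminf_eq]
    exact ENNReal.ofReal_lt_top
  have hFhat : 𝓕 F = fun w => ((p w : ℝ) : ℂ) := funext fun w => (hcos w).symm
  have hinv := hFint.fourierInv_fourier_eq (v := 0) (by rw [hFhat]; exact hpint.ofReal)
    hFc.continuousAt
  rw [hFhat, Real.fourierInv_eq] at hinv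
  simp only [inner_zero_right, AddChar.map_zero_eq_one, one_smul, integral_complex_ofReal, hF,
    Complex.ofReal_inj] at hinv
  refine ⟨(integrable_comp_smul_iff volume _ hpi).1 hpint, ?_⟩
  rw [← hinv, hp, Measure.integral_comp_smul_of_nonneg volume _ _ (hR := by positivity),
    smul_eq_mul, ← mul_assoc, mul_inv_cancel₀ (pow_ne_zero _ hpi), one_mul]

lemma cosTransform_gaussian_nonneg {b : ℝ} (hb : 0 < b) (x : V) :
    0 ≤ cosTransform (fun ξ : V => Real.exp (-b * ‖ξ‖ ^ 2)) x := by
  have he : (fun w : V => Complex.exp (-(b : ℂ) * ‖w‖ ^ 2)) =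
      fun w => ((Real.exp (-b * ‖w‖ ^ 2) : ℝ) : ℂ) := by
    ext w; push_cast; rfl
  have J' : Integrable (fun w : V => Real.exp (-b * ‖w‖ ^ 2)) := integrable_gaussian hb
  have h := ofReal_cosTransform J' (by simp) x
  rw [← he, fourier_gaussian_innerProductSpace (by simpa using hb)] at h
  have h2 : ((π / b : ℂ) ^ (Module.finrank ℝ V / 2 : ℂ) *
      Complex.exp (-π ^ 2 * ‖(2 * π)⁻¹ • x‖ ^ 2 / b)) =
      (((π / b) ^ (Module.finrank ℝ V / 2 : ℝ) *
        Real.exp (-π ^ 2 * ‖(2 * π)⁻¹ • x‖ ^ 2 / b) : ℝ) : ℂ) := by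
    rw [Complex.ofReal_mul, Complex.ofReal_cpow (by positivity)]
    push_cast
    rfl
  rw [h2, Complex.ofReal_inj] at h
  rw [h]
  positivity

end Fourier

section Positivity

variable {V : Type*} [NormedAddCommGroup V] [InnerProductSpace ℝ V] [FiniteDimensional ℝ V]
  [MeasurableSpace V] [BorelSpace V]

lemma abs_cosTransform_le {w : V → ℝ} (hw : Integrable w) (x : V) :
    |cosTransform w x| ≤ ∫ z, |w z| := by
  simpa [cosTransform] using abs_cosTransform_sub_le hw (integrable_zero V ℝ volume) x

lemma integrable_cosTransform_mul {w h : V → ℝ} (hw : Integrable w) (hh : Integrable h) :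
    Integrable (fun ξ => cosTransform w ξ * h ξ) :=
  hh.bdd_mul (c := ∫ z, |w z|) (continuous_cosTransform hw).aestronglyMeasurable
    (Eventually.of_forall fun ξ => abs_cosTransform_le hw ξ)

/-- Multiplication by the cosine transform of a nonnegative function preserves nonnegativity of
cosine transforms. -/
lemma cosTransform_cosTransform_mul_nonneg {w h : V → ℝ} (hw : Integrable w) (hw0 : ∀ z, 0 ≤ w z)
    (hh : Integrable h) (hpos : ∀ x, 0 ≤ cosTransform h x) (x : V) :
    0 ≤ cosTransform (fun ξ => cosTransform w ξ * h ξ) x := by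
  have hprod : Integrable (fun q : V × V =>
      (Real.cos ⟪q.2, q.1⟫ * Real.cos ⟪q.1, x⟫) * (h q.1 * w q.2)) (volume.prod volume) := by
    refine (hh.mul_prod hw).bdd_mul (c := 1) (Continuous.aestronglyMeasurable (by fun_prop))
      (Eventually.of_forall fun q => ?_)
    rw [norm_mul]
    exact mul_le_one₀ (Real.abs_cos_le_one _) (norm_nonneg _) (Real.abs_cos_le_one _)
  have hswap := integral_integral_swap (f := fun ξ z : V =>
      (Real.cos ⟪z, ξ⟫ * Real.cos ⟪ξ, x⟫) * (h ξ * w z)) hprod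
  have hl : cosTransform (fun ξ => cosTransform w ξ * h ξ) x =
      ∫ ξ, ∫ z, (Real.cos ⟪z, ξ⟫ * Real.cos ⟪ξ, x⟫) * (h ξ * w z) := by
    unfold cosTransform
    congr with ξ
    beta_reduce
    rw [mul_comm _ (h ξ), ← mul_assoc, ← integral_const_mul]
    congr with z
    ring
  rw [hl, hswap]
  refine integral_nonneg fun z => ?_
  have hz : ∫ ξ, (Real.cos ⟪z, ξ⟫ * Real.cos ⟪ξ, x⟫) * (h ξ * w z) =
      w z / 2 * (cosTransform h (x + z) + cosTransform h (x - z)) := by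
    unfold cosTransform
    rw [← integral_add (integrable_cos_inner_mul hh _) (integrable_cos_inner_mul hh _),
      ← integral_const_mul]
    congr with ξ
    rw [inner_add_right, inner_sub_right, Real.cos_add, Real.cos_sub, real_inner_comm ξ z]
    ring
  simp only [Pi.zero_apply]
  rw [hz]
  have := hw0 z
  have := hpos (x + z)
  have := hpos (x - z)
  positivity

lemma tendsto_cosTransform {ι : Type*} {l : Filter ι} [l.IsCountablyGenerated]
    {g : ι → V → ℝ} {f b : V → ℝ} (hg : ∀ᶠ n in l, AEStronglyMeasurable (g n) volume)
    (hb : Integrable b) (hbound : ∀ᶠ n in l, ∀ᵐ ξ, |g n ξ| ≤ b ξ)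
    (hlim : ∀ᵐ ξ, Tendsto (fun n => g n ξ) l (𝓝 (f ξ))) (x : V) :
    Tendsto (fun n => cosTransform (g n) x) l (𝓝 (cosTransform f x)) := by
  refine tendsto_integral_filter_of_dominated_convergence b ?_ ?_ hb ?_
  · filter_upwards [hg] with n hn
    exact (Continuous.aestronglyMeasurable (by fun_prop)).mul hn
  · filter_upwards [hbound] with n hn
    filter_upwards [hn] with ξ hξ
    rw [norm_mul]
    exact (mul_le_of_le_one_left (norm_nonneg _) (Real.abs_cos_le_one _)).trans hξ
  · filter_upwards [hlim] with ξ hξ using hξ.const_mul _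

lemma cosTransform_exp_mul_nonneg {w h : V → ℝ} (hw : Integrable w) (hw0 : ∀ z, 0 ≤ w z)
    (hh : Integrable h) (hpos : ∀ x, 0 ≤ cosTransform h x) {t : ℝ} (ht : 0 ≤ t) (x : V) :
    0 ≤ cosTransform (fun ξ => Real.exp (t * cosTransform w ξ) * h ξ) x := by
  have hpow : ∀ k : ℕ, Integrable (fun ξ => cosTransform w ξ ^ k * h ξ) ∧
      ∀ x, 0 ≤ cosTransform (fun ξ => cosTransform w ξ ^ k * h ξ) x := by
    intro k
    induction k with
    | zero => simpa using ⟨hh, hpos⟩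
    | succ k ih =>
      simp only [pow_succ', mul_assoc]
      exact ⟨integrable_cosTransform_mul hw ih.1,
        cosTransform_cosTransform_mul_nonneg hw hw0 ih.1 ih.2⟩
  set S : ℕ → V → ℝ := fun n ξ =>
    ∑ k ∈ Finset.range n, (t * cosTransform w ξ) ^ k / k.factorial * h ξ with hS
  have hSpos : ∀ n, 0 ≤ cosTransform (S n) x := by
    intro n
    have : cosTransform (S n) x = ∑ k ∈ Finset.range n,
        t ^ k / k.factorial * cosTransform (fun ξ => cosTransform w ξ ^ k * h ξ) x := by
      change ∫ ξ, Real.cos ⟪ξ, x⟫ * S n ξ = ∑ k ∈ Finset.range n, t ^ k / k.factorial *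
        ∫ ξ, Real.cos ⟪ξ, x⟫ * (cosTransform w ξ ^ k * h ξ)
      simp_rw [← integral_const_mul]
      rw [← integral_finsetSum _ fun k _ => (integrable_cos_inner_mul (hpow k).1 x).const_mul _]
      congr with ξ
      simp only [hS, Finset.mul_sum]
      refine Finset.sum_congr rfl fun k _ => ?_
      rw [mul_pow]
      ring
    rw [this]
    exact Finset.sum_nonneg fun k _ => mul_nonneg (by positivity) ((hpow k).2 x)
  have hcw := continuous_cosTransform hw
  refine ge_of_tendsto' (tendsto_cosTransform (g := S) (l := atTop)
    (b := fun ξ => Real.exp (t * ∫ z, |w z|) * |h ξ|) ?_ (hh.abs.const_mul _) ?_ ?_ x) hSpos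
  · refine Eventually.of_forall fun n => ?_
    simp only [hS, ← Finset.sum_mul]
    exact (Continuous.aestronglyMeasurable (by fun_prop)).mul hh.aestronglyMeasurable
  · refine Eventually.of_forall fun n => Eventually.of_forall fun ξ => ?_
    simp only [hS, ← Finset.sum_mul, abs_mul]
    refine mul_le_mul_of_nonneg_right ?_ (abs_nonneg _)
    calc |∑ k ∈ Finset.range n, (t * cosTransform w ξ) ^ k / k.factorial|
        ≤ ∑ k ∈ Finset.range n, (t * ∫ z, |w z|) ^ k / k.factorial := by
          refine (Finset.abs_sum_le_sum_abs _ _).trans (Finset.sum_le_sum fun k _ => ?_)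
          rw [abs_div, abs_pow, abs_mul, abs_of_nonneg ht, Nat.abs_cast]
          gcongr
          exact abs_cosTransform_le hw ξ
      _ ≤ _ := Real.sum_le_exp_of_nonneg (mul_nonneg ht (integral_nonneg fun z => abs_nonneg _)) n
  · refine Eventually.of_forall fun ξ => ?_
    simp only [hS, ← Finset.sum_mul]
    refine Tendsto.mul_const _ ?_
    have := (NormedSpace.expSeries_div_hasSum_exp (t * cosTransform w ξ)).tendsto_sum_nat
    rwa [← Real.exp_eq_exp_ℝ] at this

/-- If `∫ (1 - cos ⟪ξ, z⟫) w z dz` is a Lévy–Khintchine exponent whose exponential is integrable,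
the corresponding cosine transform is nonnegative. -/
theorem cosTransform_exp_neg_nonneg {w : V → ℝ} (hw0 : ∀ z ≠ 0, 0 ≤ w z)
    (hw : Integrable fun z => min (‖z‖ ^ 2) 1 * w z)
    (hψ : ∀ ξ, Integrable fun z => (1 - Real.cos ⟪ξ, z⟫) * w z)
    (hψc : Continuous fun ξ => ∫ z, (1 - Real.cos ⟪ξ, z⟫) * w z)
    {t : ℝ} (ht : 0 ≤ t)
    (hexp : Integrable fun ξ => Real.exp (-(t * ∫ z, (1 - Real.cos ⟪ξ, z⟫) * w z))) (x : V) :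
    0 ≤ cosTransform (fun ξ => Real.exp (-(t * ∫ z, (1 - Real.cos ⟪ξ, z⟫) * w z))) x := by
  set Ψ : V → ℝ := fun ξ => ∫ z, (1 - Real.cos ⟪ξ, z⟫) * w z with hΨ
  have hcos0 : ∀ y : ℝ, 0 ≤ 1 - Real.cos y := fun y => by linarith [Real.cos_le_one y]
  have hcosw : ∀ ξ z, 0 ≤ (1 - Real.cos ⟪ξ, z⟫) * w z := by
    intro ξ z
    rcases eq_or_ne z 0 with rfl | hz
    · simp
    · exact mul_nonneg (hcos0 _) (hw0 z hz)
  set s : ℕ → Set V := fun n => {z | ((n : ℝ) + 1)⁻¹ ≤ ‖z‖} with hs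
  have hsm : ∀ n, MeasurableSet (s n) := fun n => measurableSet_le measurable_const measurable_norm
  have hwn0 : ∀ n z, 0 ≤ (s n).indicator w z := fun n z =>
    Set.indicator_nonneg (fun z hz => hw0 z (norm_pos_iff.1
      (lt_of_lt_of_le (by positivity) (show ((n : ℝ) + 1)⁻¹ ≤ ‖z‖ from hz)))) z
  have hwn : ∀ n, Integrable ((s n).indicator w) := by
    intro n
    have h1 : Integrable ((s n).indicator fun z => min (‖z‖ ^ 2) 1 * w z) :=
      hw.indicator (hsm n)
    have hbd : ∀ z ∈ s n, (min (‖z‖ ^ 2) 1)⁻¹ ≤ ((n : ℝ) + 1) ^ 2 := by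
      intro z hz
      have hz' : ((n : ℝ) + 1)⁻¹ ≤ ‖z‖ := hz
      rw [inv_le_comm₀ (by have : 0 < ‖z‖ := lt_of_lt_of_le (by positivity) hz'
                           positivity) (by positivity)]
      refine le_min ?_ ?_
      · rw [← inv_pow]
        gcongr
      · exact inv_le_one_of_one_le₀ (by nlinarith [(Nat.cast_nonneg n : (0:ℝ) ≤ n)])
    have h2 := h1.bdd_mul (c := ((n : ℝ) + 1) ^ 2)
      (f := (s n).indicator fun z => (min (‖z‖ ^ 2) 1)⁻¹)
      ((Measurable.indicator (by fun_prop) (hsm n)).aestronglyMeasurable)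
      (Eventually.of_forall fun z => by
        by_cases hz : z ∈ s n
        · rw [Set.indicator_of_mem hz, Real.norm_of_nonneg (by positivity)]
          exact hbd z hz
        · rw [Set.indicator_of_notMem hz, norm_zero]; positivity)
    refine h2.congr (Eventually.of_forall fun z => ?_)
    by_cases hz : z ∈ s n
    · have hz' : 0 < ‖z‖ := lt_of_lt_of_le (by positivity) (show ((n : ℝ) + 1)⁻¹ ≤ ‖z‖ from hz)
      have : min (‖z‖ ^ 2) 1 ≠ 0 := by positivity
      simp only [Set.indicator_of_mem hz]
      rw [← mul_assoc, inv_mul_cancel₀ this, one_mul]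
    · simp only [Set.indicator_of_notMem hz, mul_zero]
  set Ψn : ℕ → V → ℝ := fun n ξ => ∫ z, (1 - Real.cos ⟪ξ, z⟫) * (s n).indicator w z with hΨn
  have hΨn_eq : ∀ n ξ, Ψn n ξ = (∫ z, (s n).indicator w z) - cosTransform ((s n).indicator w) ξ := by
    intro n ξ
    have h := integrable_cos_inner_mul (hwn n) ξ
    unfold cosTransform
    rw [← integral_sub (hwn n) h]
    simp only [hΨn]
    congr with z
    rw [real_inner_comm]
    ring
  have hΨn0 : ∀ n ξ, 0 ≤ Ψn n ξ := fun n ξ =>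
    integral_nonneg fun z => mul_nonneg (hcos0 _) (hwn0 n z)
  have hΨn_cont : ∀ n, Continuous (Ψn n) := fun n => by
    simp only [funext (hΨn_eq n)]
    exact continuous_const.sub (continuous_cosTransform (hwn n))
  have hΨn_lim : ∀ ξ, Tendsto (fun n => Ψn n ξ) atTop (𝓝 (Ψ ξ)) := by
    intro ξ
    refine tendsto_integral_of_dominated_convergence (fun z => (1 - Real.cos ⟪ξ, z⟫) * w z)
      (fun n => ?_) (hψ ξ) (fun n => Eventually.of_forall fun z => ?_)
      (Eventually.of_forall fun z => ?_)
    · exact (Continuous.aestronglyMeasurable (by fun_prop)).mul (hwn n).aestronglyMeasurable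
    · rw [Real.norm_of_nonneg (mul_nonneg (hcos0 _) (hwn0 n z))]
      by_cases hz : z ∈ s n
      · rw [Set.indicator_of_mem hz]
      · rw [Set.indicator_of_notMem hz, mul_zero]
        exact hcosw ξ z
    · rcases eq_or_ne z 0 with rfl | hz
      · simp
      · refine tendsto_const_nhds.congr' ?_
        have h := tendsto_one_div_add_atTop_nhds_zero_nat (𝕜 := ℝ)
        filter_upwards [h.eventually (ge_mem_nhds (norm_pos_iff.2 hz))] with n hn
        rw [Set.indicator_of_mem]
        simpa [hs] using hn
  have hgauss : ∀ ε : ℝ, 0 < ε →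
      0 ≤ cosTransform (fun ξ => Real.exp (-(t * Ψ ξ)) * Real.exp (-ε * ‖ξ‖ ^ 2)) x := by
    intro ε hε
    refine ge_of_tendsto' (tendsto_cosTransform (l := atTop)
      (g := fun n ξ => Real.exp (-(t * Ψn n ξ)) * Real.exp (-ε * ‖ξ‖ ^ 2))
      (b := fun ξ => Real.exp (-ε * ‖ξ‖ ^ 2)) ?_ (integrable_gaussian hε) ?_ ?_ x) ?_
    · exact Eventually.of_forall fun n => Continuous.aestronglyMeasurable
        (by have := hΨn_cont n; fun_prop)
    · refine Eventually.of_forall fun n => Eventually.of_forall fun ξ => ?_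
      rw [abs_mul, Real.abs_exp, Real.abs_exp]
      refine mul_le_of_le_one_left (Real.exp_pos _).le (Real.exp_le_one_iff.2 ?_)
      have := mul_nonneg ht (hΨn0 n ξ)
      linarith
    · exact Eventually.of_forall fun ξ => Tendsto.mul_const _
        ((Real.continuous_exp.tendsto _).comp ((hΨn_lim ξ).const_mul t).neg)
    · intro n
      have h := cosTransform_exp_mul_nonneg (hwn n) (hwn0 n) (integrable_gaussian hε)
        (cosTransform_gaussian_nonneg hε) ht x
      have he : cosTransform (fun ξ => Real.exp (-(t * Ψn n ξ)) * Real.exp (-ε * ‖ξ‖ ^ 2)) x =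
          Real.exp (-(t * ∫ z, (s n).indicator w z)) * cosTransform (fun ξ =>
            Real.exp (t * cosTransform ((s n).indicator w) ξ) * Real.exp (-ε * ‖ξ‖ ^ 2)) x := by
        conv_rhs => unfold cosTransform
        rw [← integral_const_mul, cosTransform]
        congr with ξ
        have : -(t * Ψn n ξ) = -(t * ∫ z, (s n).indicator w z) +
            t * cosTransform ((s n).indicator w) ξ := by rw [hΨn_eq]; ring
        rw [this, Real.exp_add]
        simp only [cosTransform]
        ring
      rw [he]
      exact mul_nonneg (Real.exp_pos _).le h
  refine ge_of_tendsto (tendsto_cosTransform (l := 𝓝[>] (0 : ℝ))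
      (g := fun ε ξ => Real.exp (-(t * Ψ ξ)) * Real.exp (-ε * ‖ξ‖ ^ 2))
      (b := fun ξ => Real.exp (-(t * Ψ ξ))) ?_ hexp ?_ ?_ x) ?_
  · exact Eventually.of_forall fun ε => Continuous.aestronglyMeasurable (by fun_prop)
  · filter_upwards [self_mem_nhdsWithin] with ε (hε : 0 < ε)
    refine Eventually.of_forall fun ξ => ?_
    rw [abs_mul, Real.abs_exp, Real.abs_exp]
    refine mul_le_of_le_one_right (Real.exp_pos _).le (Real.exp_le_one_iff.2 ?_)
    have : 0 ≤ ε * ‖ξ‖ ^ 2 := by positivity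
    linarith
  · refine Eventually.of_forall fun ξ => ?_
    have hc : Continuous fun ε : ℝ => Real.exp (-(t * Ψ ξ)) * Real.exp (-ε * ‖ξ‖ ^ 2) := by
      fun_prop
    have := (hc.tendsto 0).mono_left (nhdsWithin_le_nhds (s := Set.Ioi 0))
    simpa using this
  · filter_upwards [self_mem_nhdsWithin] with ε hε using hgauss ε hε

end Positivity

section RegularVariation

/-- Potter-type bounds for a positive non-increasing function whose dyadic ratios converge. -/
lemma exists_potter_bounds {ν : ℝ → ℝ} (hν_pos : ∀ r : ℝ, 0 < r → 0 < ν r)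
    (hν_mono : ∀ r₁ r₂ : ℝ, 0 < r₁ → r₁ ≤ r₂ → ν r₂ ≤ ν r₁) {β δ : ℝ} (hδ : 0 < δ) (hδβ : δ < β)
    (h2 : Tendsto (fun r : ℝ => ν (2 * r) / ν r) atTop (𝓝 ((2 : ℝ) ^ (-β)))) :
    ∃ A : ℝ, 1 ≤ A ∧ ∀ R, A ≤ R → ∀ ρ, 1 ≤ ρ →
      ν (ρ * R) ≤ 2 ^ (β + δ) * ρ ^ (-(β - δ)) * ν R ∧
      ν R ≤ 2 ^ (β + δ) * ρ ^ (β + δ) * ν (ρ * R) := by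
  have hlo : (2 : ℝ) ^ (-(β + δ)) < 2 ^ (-β) :=
    Real.rpow_lt_rpow_of_exponent_lt one_lt_two (by linarith)
  have hhi : (2 : ℝ) ^ (-β) < 2 ^ (-(β - δ)) :=
    Real.rpow_lt_rpow_of_exponent_lt one_lt_two (by linarith)
  obtain ⟨A₀, hA₀⟩ := eventually_atTop.1 (h2.eventually (Ioo_mem_nhds hlo hhi))
  refine ⟨max A₀ 1, le_max_right _ _, fun R hR ρ hρ => ?_⟩
  have hR0 : 0 < R := lt_of_lt_of_le one_pos ((le_max_right _ _).trans hR)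
  have hstep : ∀ k : ℕ, ν (2 ^ k * R) ≤ ((2 : ℝ) ^ k) ^ (-(β - δ)) * ν R ∧
      ν R ≤ ((2 : ℝ) ^ k) ^ (β + δ) * ν (2 ^ k * R) := by
    intro k
    induction k with
    | zero => simp
    | succ k ih =>
      have hk : A₀ ≤ 2 ^ k * R := by
        have : R ≤ 2 ^ k * R := le_mul_of_one_le_left hR0.le (one_le_pow₀ one_le_two)
        exact ((le_max_left _ _).trans hR).trans this
      have hp : 0 < ν (2 ^ k * R) := hν_pos _ (by positivity)
      obtain ⟨h1, h2⟩ := hA₀ _ hk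
      rw [lt_div_iff₀ hp] at h1
      rw [div_lt_iff₀ hp] at h2
      have e : (2 : ℝ) ^ (k + 1) * R = 2 * (2 ^ k * R) := by ring
      have e2 : ∀ p : ℝ, ((2 : ℝ) ^ (k + 1)) ^ p = 2 ^ p * (2 ^ k) ^ p := fun p => by
        rw [pow_succ', Real.mul_rpow (by norm_num) (by positivity)]
      rw [e, e2, e2]
      refine ⟨h2.le.trans ?_, ih.2.trans ?_⟩
      · rw [mul_assoc]
        gcongr
        exact ih.1
      · have h3 : ν (2 ^ k * R) ≤ 2 ^ (β + δ) * ν (2 * (2 ^ k * R)) := by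
          rw [Real.rpow_neg (by norm_num), inv_mul_lt_iff₀ (by positivity)] at h1
          exact h1.le
        rw [mul_comm ((2 : ℝ) ^ (β + δ)), mul_assoc]
        gcongr
  obtain ⟨k, hk1, hk2⟩ := exists_nat_pow_near hρ (one_lt_two (α := ℝ))
  have hρ0 : 0 < ρ := by linarith
  have hR' := hν_pos R hR0
  constructor
  · calc ν (ρ * R) ≤ ν (2 ^ k * R) :=
          hν_mono _ _ (by positivity) (mul_le_mul_of_nonneg_right hk1 hR0.le)
      _ ≤ ((2 : ℝ) ^ k) ^ (-(β - δ)) * ν R := (hstep k).1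
      _ ≤ (2 ^ (β + δ) * ρ ^ (-(β - δ))) * ν R := by
          gcongr
          have h : ((2 : ℝ) ^ (k + 1)) ^ (-(β - δ)) ≤ ρ ^ (-(β - δ)) :=
            Real.rpow_le_rpow_of_nonpos hρ0 hk2.le (by linarith)
          rw [pow_succ', Real.mul_rpow (by norm_num) (by positivity),
            Real.rpow_neg (by norm_num) (β - δ), inv_mul_le_iff₀ (by positivity)] at h
          refine h.trans ?_
          gcongr
          · norm_num
          · linarith
  · calc ν R ≤ ((2 : ℝ) ^ (k + 1)) ^ (β + δ) * ν (2 ^ (k + 1) * R) := (hstep (k + 1)).2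
      _ ≤ (2 ^ (β + δ) * ρ ^ (β + δ)) * ν (ρ * R) := by
          have h1 : ν (2 ^ (k + 1) * R) ≤ ν (ρ * R) :=
            hν_mono _ _ (by positivity) (mul_le_mul_of_nonneg_right hk2.le hR0.le)
          have h2 : ((2 : ℝ) ^ (k + 1)) ^ (β + δ) ≤ 2 ^ (β + δ) * ρ ^ (β + δ) := by
            rw [pow_succ', Real.mul_rpow (by norm_num) (by positivity)]
            have : 0 ≤ β + δ := by linarith
            gcongr
          have h3 : 0 ≤ ν (2 ^ (k + 1) * R) := (hν_pos _ (by positivity)).le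
          exact mul_le_mul h2 h1 h3 (by positivity)

end RegularVariation

section Exponent

lemma one_sub_cos_nonneg (y : ℝ) : 0 ≤ 1 - Real.cos y := by linarith [Real.cos_le_one y]

variable {V : Type*} [NormedAddCommGroup V] [InnerProductSpace ℝ V]

lemma one_sub_cos_inner_le_sq (ξ z : V) : 1 - Real.cos ⟪ξ, z⟫ ≤ ‖ξ‖ ^ 2 * ‖z‖ ^ 2 := by
  have h := Real.one_sub_sq_div_two_le_cos (x := ⟪ξ, z⟫)
  have h2 : ⟪ξ, z⟫ ^ 2 ≤ (‖ξ‖ * ‖z‖) ^ 2 := by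
    rw [sq_le_sq, abs_of_nonneg (a := ‖ξ‖ * ‖z‖) (by positivity)]
    exact abs_real_inner_le_norm ξ z
  nlinarith [sq_nonneg (‖ξ‖ * ‖z‖)]

lemma one_sub_cos_inner_le_min (ξ z : V) :
    1 - Real.cos ⟪ξ, z⟫ ≤ (‖ξ‖ ^ 2 + 2) * min (‖z‖ ^ 2) 1 := by
  rcases le_total (‖z‖ ^ 2) 1 with h | h
  · rw [min_eq_left h]
    have := one_sub_cos_inner_le_sq ξ z
    nlinarith [sq_nonneg ‖z‖]
  · rw [min_eq_right h]
    nlinarith [Real.neg_one_le_cos ⟪ξ, z⟫, sq_nonneg ‖ξ‖]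

variable [FiniteDimensional ℝ V] [MeasurableSpace V] [BorelSpace V]

lemma aestronglyMeasurable_of_min_mul [Nontrivial V] {w : V → ℝ}
    (hw : Integrable fun z => min (‖z‖ ^ 2) 1 * w z) : AEStronglyMeasurable w volume := by
  have h : AEStronglyMeasurable (fun z : V => (min (‖z‖ ^ 2) 1)⁻¹) volume :=
    (by fun_prop : Measurable fun z : V => (min (‖z‖ ^ 2) 1)⁻¹).aestronglyMeasurable
  refine (h.mul hw.aestronglyMeasurable).congr ?_
  filter_upwards [Measure.ae_ne volume 0] with z hz
  have : min (‖z‖ ^ 2) 1 ≠ 0 := by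
    have := norm_pos_iff.2 hz
    positivity
  simp only [Pi.mul_apply]
  rw [← mul_assoc, inv_mul_cancel₀ this, one_mul]

lemma integrable_one_sub_cos_mul [Nontrivial V] {w : V → ℝ} (hw0 : ∀ z ≠ 0, 0 ≤ w z)
    (hw : Integrable fun z => min (‖z‖ ^ 2) 1 * w z) (ξ : V) :
    Integrable fun z => (1 - Real.cos ⟪ξ, z⟫) * w z := by
  refine (hw.const_mul (‖ξ‖ ^ 2 + 2)).mono' ?_ ?_
  · exact (Continuous.aestronglyMeasurable (by fun_prop)).mul (aestronglyMeasurable_of_min_mul hw)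
  · filter_upwards [Measure.ae_ne volume 0] with z hz
    rw [Real.norm_of_nonneg (mul_nonneg (one_sub_cos_nonneg _) (hw0 z hz)), ← mul_assoc]
    exact mul_le_mul_of_nonneg_right (one_sub_cos_inner_le_min ξ z) (hw0 z hz)

lemma continuous_integral_one_sub_cos_mul [Nontrivial V] {w : V → ℝ} (hw0 : ∀ z ≠ 0, 0 ≤ w z)
    (hw : Integrable fun z => min (‖z‖ ^ 2) 1 * w z) :
    Continuous fun ξ : V => ∫ z, (1 - Real.cos ⟪ξ, z⟫) * w z := by
  refine continuous_iff_continuousAt.2 fun ξ₀ => ?_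
  refine continuousAt_of_dominated
    (bound := fun z => ((‖ξ₀‖ + 1) ^ 2 + 2) * (min (‖z‖ ^ 2) 1 * w z))
    (Eventually.of_forall fun ξ => (integrable_one_sub_cos_mul hw0 hw ξ).aestronglyMeasurable)
    ?_ (hw.const_mul _) (Eventually.of_forall fun z => by fun_prop)
  filter_upwards [Metric.ball_mem_nhds ξ₀ one_pos] with ξ hξ
  filter_upwards [Measure.ae_ne volume 0] with z hz
  rw [Real.norm_of_nonneg (mul_nonneg (one_sub_cos_nonneg _) (hw0 z hz)), ← mul_assoc]
  have h1 : ‖ξ‖ ≤ ‖ξ₀‖ + 1 := by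
    have := norm_le_norm_add_norm_sub' ξ ξ₀
    rw [mem_ball_iff_norm] at hξ
    linarith
  refine mul_le_mul_of_nonneg_right ((one_sub_cos_inner_le_min ξ z).trans ?_) (hw0 z hz)
  gcongr

lemma integral_one_sub_cos_mul_pos [Nontrivial V] {w : V → ℝ} (hw0 : ∀ z ≠ 0, 0 < w z) {ξ : V}
    (hξ : ξ ≠ 0) (hint : Integrable fun z => (1 - Real.cos ⟪ξ, z⟫) * w z) :
    0 < ∫ z, (1 - Real.cos ⟪ξ, z⟫) * w z := by
  have h0 : 0 ≤ᵐ[volume] fun z => (1 - Real.cos ⟪ξ, z⟫) * w z := by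
    filter_upwards [Measure.ae_ne volume 0] with z hz
    exact mul_nonneg (one_sub_cos_nonneg _) (hw0 z hz).le
  refine lt_of_le_of_ne (integral_nonneg_of_ae h0) fun h => ?_
  have h1 := (integral_eq_zero_iff_of_nonneg_ae h0 hint).1 h.symm
  have h2 : (fun z : V => 1 - Real.cos ⟪ξ, z⟫) =ᵐ[volume] fun _ => 0 := by
    filter_upwards [h1, Measure.ae_ne volume 0] with z hz hz0
    exact (mul_eq_zero.1 hz).resolve_right (hw0 z hz0).ne'
  have h3 := congrFun ((Continuous.ae_eq_iff_eq volume (by fun_prop) (by fun_prop)).1 h2)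
    ((π / ‖ξ‖ ^ 2) • ξ)
  have hn : ‖ξ‖ ≠ 0 := norm_ne_zero_iff.2 hξ
  rw [inner_smul_right, real_inner_self_eq_norm_sq, div_mul_cancel₀ _ (pow_ne_zero 2 hn),
    Real.cos_pi] at h3
  norm_num at h3

lemma integral_one_sub_cos_mul_radial (ν : ℝ → ℝ) {ξ η : V} (h : ‖ξ‖ = ‖η‖) :
    ∫ z, (1 - Real.cos ⟪ξ, z⟫) * ν ‖z‖ = ∫ z, (1 - Real.cos ⟪η, z⟫) * ν ‖z‖ := by
  set T : V ≃ₗᵢ[ℝ] V := (ℝ ∙ (ξ - η))ᗮ.reflection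
  have hT : T ξ = η := Submodule.reflection_sub h
  have := T.measurePreserving.integral_comp T.toHomeomorph.measurableEmbedding
    (fun z => (1 - Real.cos ⟪η, z⟫) * ν ‖z‖)
  rw [← this]
  congr with z
  rw [← hT, T.inner_map_map, T.norm_map]

/-- A Lévy–Khintchine exponent is bounded below away from a compact neighbourhood of the
origin. -/
lemma exists_pos_le_integral_one_sub_cos_mul [Nontrivial V] {w : V → ℝ} (hw0 : ∀ z ≠ 0, 0 < w z)
    (hw : Integrable fun z => min (‖z‖ ^ 2) 1 * w z) {r : ℝ} (hr : 0 < r) :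
    ∃ c > 0, ∀ ξ : V, r ≤ ‖ξ‖ → c ≤ ∫ z, (1 - Real.cos ⟪ξ, z⟫) * w z := by
  have hw0' : ∀ z ≠ 0, 0 ≤ w z := fun z hz => (hw0 z hz).le
  set s : Set V := {z | 1 ≤ ‖z‖} with hs
  have hsm : MeasurableSet s := measurableSet_le measurable_const measurable_norm
  have hne : ∀ z ∈ s, z ≠ 0 := fun z hz => norm_pos_iff.1 (lt_of_lt_of_le one_pos hz)
  have hws : Integrable (s.indicator w) := by
    refine (hw.indicator hsm).congr (Eventually.of_forall fun z => ?_)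
    by_cases hz : z ∈ s
    · simp only [Set.indicator_of_mem hz]
      rw [min_eq_right (one_le_pow₀ hz), one_mul]
    · simp only [Set.indicator_of_notMem hz]
  have hws0 : ∀ z, 0 ≤ s.indicator w z := fun z =>
    Set.indicator_nonneg (fun z hz => hw0' z (hne z hz)) z
  have hpos : 0 < ∫ z, s.indicator w z := by
    rw [integral_pos_iff_support_of_nonneg hws0 hws]
    obtain ⟨v, hv⟩ := exists_ne (0 : V)
    have hv' : 0 < ‖v‖ := norm_pos_iff.2 hv
    refine lt_of_lt_of_le (Metric.measure_ball_pos volume ((2 / ‖v‖) • v) one_pos)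
      (measure_mono fun z hz => ?_)
    have hz1 : 1 ≤ ‖z‖ := by
      have h1 : ‖(2 / ‖v‖) • v‖ = 2 := by
        rw [norm_smul, Real.norm_of_nonneg (by positivity), div_mul_cancel₀ _ hv'.ne']
      have h2 := norm_le_norm_add_norm_sub z ((2 / ‖v‖) • v)
      rw [mem_ball_iff_norm] at hz
      linarith
    rw [Function.mem_support, Set.indicator_of_mem (show z ∈ s from hz1)]
    exact (hw0 z (hne z hz1)).ne'
  set lam := ∫ z, s.indicator w z with hlam
  have hRL : Tendsto (fun ξ : V => cosTransform (s.indicator w) ξ) (cocompact V) (𝓝 0) := by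
    have h := tendsto_integral_exp_inner_smul_cocompact
      (fun z : V => ((s.indicator w z : ℝ) : ℂ))
    have h' := (Complex.continuous_re.tendsto _).comp
      (h.comp ((Homeomorph.smulOfNeZero ((2 * π)⁻¹ : ℝ) (by positivity)).isClosedEmbedding
        (X := V)).tendsto_cocompact)
    refine h'.congr fun ξ => ?_
    have hi : Integrable (fun v : V => Real.fourierChar (-⟪v, (2 * π)⁻¹ • ξ⟫) •
        ((s.indicator w v : ℝ) : ℂ)) := by
      exact (Real.fourierIntegral_convergent_iff _).2 hws.ofReal
    simp only [Function.comp_apply, Homeomorph.smulOfNeZero_apply]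
    rw [cosTransform]
    refine (integral_re hi).symm.trans ?_
    congr with v
    have : -(2 * π * ⟪v, (2 * π)⁻¹ • ξ⟫) = -⟪v, ξ⟫ := by
      rw [inner_smul_right]; field_simp
    rw [Circle.smul_def, Real.fourierChar_apply, mul_neg, this, smul_eq_mul]
    change (_ : ℂ).re = _
    rw [Complex.re_mul_ofReal, Complex.exp_ofReal_mul_I_re, Real.cos_neg]
  have hlarge : ∀ᶠ ξ : V in cocompact V, lam / 2 ≤ ∫ z, (1 - Real.cos ⟪ξ, z⟫) * w z := by
    filter_upwards [hRL.eventually (gt_mem_nhds (half_pos hpos))] with ξ hξ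
    have h1 : ∫ z, (1 - Real.cos ⟪ξ, z⟫) * s.indicator w z =
        lam - cosTransform (s.indicator w) ξ := by
      rw [cosTransform, hlam, ← integral_sub hws (integrable_cos_inner_mul hws ξ)]
      congr with z
      rw [real_inner_comm]
      ring
    have h2 : ∫ z, (1 - Real.cos ⟪ξ, z⟫) * s.indicator w z ≤
        ∫ z, (1 - Real.cos ⟪ξ, z⟫) * w z := by
      refine integral_mono_of_nonneg (Eventually.of_forall fun z =>
        mul_nonneg (one_sub_cos_nonneg _) (hws0 z)) (integrable_one_sub_cos_mul hw0' hw ξ) ?_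
      filter_upwards [Measure.ae_ne volume 0] with z hz
      refine mul_le_mul_of_nonneg_left ?_ (one_sub_cos_nonneg _)
      by_cases h : z ∈ s
      · rw [Set.indicator_of_mem h]
      · rw [Set.indicator_of_notMem h]; exact hw0' z hz
    linarith
  obtain ⟨t, ht, htc⟩ := mem_cocompact.1 hlarge
  set k : Set V := t ∩ {ξ | r ≤ ‖ξ‖} with hk
  have hkc : IsCompact k := ht.inter_right (isClosed_le continuous_const continuous_norm)
  have hpos' : ∀ ξ : V, r ≤ ‖ξ‖ → 0 < ∫ z, (1 - Real.cos ⟪ξ, z⟫) * w z := fun ξ hξ =>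
    integral_one_sub_cos_mul_pos hw0 (norm_pos_iff.1 (hr.trans_le hξ))
      (integrable_one_sub_cos_mul hw0' hw ξ)
  rcases k.eq_empty_or_nonempty with hke | hkn
  · refine ⟨lam / 2, half_pos hpos, fun ξ hξ => htc fun h => ?_⟩
    exact Set.notMem_empty ξ (hke ▸ ⟨h, hξ⟩)
  · obtain ⟨ξ₁, hξ₁, hmin⟩ := hkc.exists_isMinOn hkn
      (continuous_integral_one_sub_cos_mul hw0' hw).continuousOn
    refine ⟨min (lam / 2) _, lt_min (half_pos hpos) (hpos' ξ₁ hξ₁.2), fun ξ hξ => ?_⟩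
    by_cases h : ξ ∈ t
    · exact (min_le_right _ _).trans (hmin ⟨h, hξ⟩)
    · exact (min_le_left _ _).trans (htc h)

end Exponent

section ExponentAsymptotics

variable {V : Type*} [NormedAddCommGroup V] [InnerProductSpace ℝ V] [FiniteDimensional ℝ V]
  [MeasurableSpace V] [BorelSpace V]

lemma aestronglyMeasurable_comp_mul_norm [Nontrivial V] {f : ℝ → ℝ} (hf : Measurable (f ∘ Real.exp))
    {c : ℝ} (hc : 0 < c) : AEStronglyMeasurable (fun z : V => f (c * ‖z‖)) volume := by
  have h : Measurable fun z : V => (f ∘ Real.exp) (Real.log (c * ‖z‖)) :=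
    hf.comp (Real.measurable_log.comp (measurable_const.mul measurable_norm))
  refine h.aestronglyMeasurable.congr ?_
  filter_upwards [Measure.ae_ne volume 0] with z hz
  have := norm_pos_iff.2 hz
  rw [Function.comp_apply, Real.exp_log (by positivity)]

lemma integrable_ite_rpow_norm [Nontrivial V] {a b : ℝ} (ha : 0 < Module.finrank ℝ V + a)
    (hb : Module.finrank ℝ V + b < 0) :
    Integrable fun z : V => if ‖z‖ < 1 then ‖z‖ ^ a else ‖z‖ ^ b := by
  have hn : 1 ≤ Module.finrank ℝ V := Module.finrank_pos
  refine (integrable_fun_norm_addHaar volume (f := fun y : ℝ => if y < 1 then y ^ a else y ^ b)).2 ?_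
  have key : ∀ (y p : ℝ), 0 < y →
      y ^ (Module.finrank ℝ V - 1) * y ^ p = y ^ (Module.finrank ℝ V - 1 + p) := by
    intro y p hy
    rw [← Real.rpow_natCast, ← Real.rpow_add hy, Nat.cast_sub hn, Nat.cast_one]
  rw [← Set.Ioo_union_Ici_eq_Ioi (zero_lt_one' ℝ)]
  refine IntegrableOn.union ?_ ?_
  · refine ((intervalIntegral.integrableOn_Ioo_rpow_iff (s := Module.finrank ℝ V - 1 + a)
      zero_lt_one).2 (by linarith)).congr_fun (fun y hy => ?_) measurableSet_Ioo
    simp only [smul_eq_mul, if_pos hy.2, key y a hy.1]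
  · rw [integrableOn_Ici_iff_integrableOn_Ioi]
    refine (integrableOn_Ioi_rpow_of_lt (a := Module.finrank ℝ V - 1 + b) (by linarith)
      zero_lt_one).congr_fun (fun y hy => ?_) measurableSet_Ioi
    have hy : 1 < y := hy
    simp only [smul_eq_mul, if_neg hy.not_gt, key y b (by linarith)]

/-- The Lévy–Khintchine exponent of a regularly varying isotropic unimodal Lévy density is
comparable at the origin with `r ↦ ν (1 / r) / r ^ n`. -/
theorem exists_tendsto_integral_one_sub_cos_mul [Nontrivial V] {ν : ℝ → ℝ}
    (hν_pos : ∀ r : ℝ, 0 < r → 0 < ν r)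
    (hν_mono : ∀ r₁ r₂ : ℝ, 0 < r₁ → r₁ ≤ r₂ → ν r₂ ≤ ν r₁)
    (hint : Integrable fun z : V => min (‖z‖ ^ 2) 1 * ν ‖z‖)
    {α : ℝ} (hα : α ∈ Set.Ioo (0 : ℝ) 2)
    (hrv : ∀ lam : ℝ, 0 < lam → Tendsto (fun r : ℝ => ν (lam * r) / ν r) atTop
      (𝓝 (lam ^ (-(Module.finrank ℝ V : ℝ) - α)))) {e : V} (he : ‖e‖ = 1) :
    ∃ C > 0, Tendsto (fun r : ℝ => (∫ z, (1 - Real.cos ⟪r • e, z⟫) * ν ‖z‖) *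
      (r ^ Module.finrank ℝ V / ν r⁻¹)) (𝓝[>] 0) (𝓝 C) := by
  set n := Module.finrank ℝ V with hn
  set β : ℝ := n + α with hβ
  set δ : ℝ := min α (2 - α) / 2 with hδ
  have hα0 := hα.1
  have hα2 := hα.2
  have hδ0 : 0 < δ := by
    have : 0 < min α (2 - α) := lt_min hα0 (by linarith)
    positivity
  have hδα : δ < α := by have := min_le_left α (2 - α); linarith
  have hδ2 : α + δ < 2 := by have := min_le_right α (2 - α); linarith
  have hn0 : (0 : ℝ) ≤ n := Nat.cast_nonneg n
  have hβe : -(n : ℝ) - α = -β := by rw [hβ]; ring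
  rw [hβe] at hrv
  obtain ⟨A, hA1, hA⟩ := exists_potter_bounds hν_pos hν_mono hδ0 (by linarith : δ < β)
    (hrv 2 two_pos)
  have hA0 : 0 < A := by linarith
  set M : ℝ := 2 ^ (β + δ) with hM
  have hM0 : 0 < M := by positivity
  have hνpos' : ∀ z : V, z ≠ 0 → 0 < ν ‖z‖ := fun z hz => hν_pos _ (norm_pos_iff.2 hz)
  have hνexp : Measurable (ν ∘ Real.exp) := by
    have : Antitone (ν ∘ Real.exp) := fun x y hxy =>
      hν_mono _ _ (Real.exp_pos x) (Real.exp_le_exp.2 hxy)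
    exact this.measurable
  set νA : ℝ → ℝ := (Set.Ici A).indicator ν with hνA
  have hνA0 : ∀ y, 0 ≤ νA y := fun y =>
    Set.indicator_nonneg (fun y hy => (hν_pos y (hA0.trans_le hy)).le) y
  have hνAexp : Measurable (νA ∘ Real.exp) := by
    have : νA ∘ Real.exp = (Real.exp ⁻¹' Set.Ici A).indicator (ν ∘ Real.exp) := by
      ext y; simp [hνA, Set.indicator]
    rw [this]
    exact hνexp.indicator (Real.measurable_exp measurableSet_Ici)
  have hνAle : ∀ z : V, z ≠ 0 → νA ‖z‖ ≤ ν ‖z‖ := fun z hz =>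
    Set.indicator_le' (fun _ _ => le_rfl) (fun _ _ => (hνpos' z hz).le) _
  -- the exponent of the part of the Lévy measure outside the ball of radius `A`
  set J : ℝ → ℝ := fun r => ∫ z : V, (1 - Real.cos ⟪r • e, z⟫) * νA ‖z‖ with hJ
  set g : ℝ → V → ℝ := fun r x => (1 - Real.cos ⟪e, x⟫) * (νA (r⁻¹ * ‖x‖) / ν r⁻¹) with hg
  have hJg : ∀ r, 0 < r → J r * (r ^ n / ν r⁻¹) = ∫ x, g r x := by
    intro r hr
    have h := Measure.integral_comp_inv_smul_of_nonneg (volume : Measure V)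
      (fun z : V => (1 - Real.cos ⟪r • e, z⟫) * νA ‖z‖) hr.le
    have h2 : ∫ x, g r x = (∫ x : V, (1 - Real.cos ⟪r • e, r⁻¹ • x⟫) * νA ‖r⁻¹ • x‖) / ν r⁻¹ := by
      rw [← integral_div]
      congr with x
      rw [real_inner_smul_left, inner_smul_right, mul_inv_cancel_left₀ hr.ne', norm_smul,
        Real.norm_of_nonneg (inv_nonneg.2 hr.le)]
      simp only [hg]
      ring
    rw [h2, h, smul_eq_mul]
    simp only [hJ]
    ring
  set B : V → ℝ := fun x => 3 * M * if ‖x‖ < 1 then ‖x‖ ^ (2 - β - δ) else ‖x‖ ^ (-(β - δ)) with hB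
  have hBint : Integrable B := by
    refine (integrable_ite_rpow_norm ?_ ?_).const_mul _
    · rw [hβ, ← hn]; linarith
    · rw [hβ, ← hn]; linarith
  have hgbound : ∀ r, 0 < r → r < A⁻¹ → ∀ x : V, x ≠ 0 → ‖g r x‖ ≤ B x := by
    intro r hr hrA x hx
    have hx0 : 0 < ‖x‖ := norm_pos_iff.2 hx
    have hrA' : A ≤ r⁻¹ := by rw [le_inv_comm₀ hA0 hr]; exact hrA.le
    have hνr : 0 < ν r⁻¹ := hν_pos _ (by positivity)
    have hg0 : 0 ≤ g r x :=
      mul_nonneg (one_sub_cos_nonneg _) (div_nonneg (hνA0 _) hνr.le)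
    rw [Real.norm_of_nonneg hg0]
    have hcos := one_sub_cos_inner_le_min e x
    rw [he] at hcos
    by_cases hAx : A ≤ r⁻¹ * ‖x‖
    · have hνAx : νA (r⁻¹ * ‖x‖) = ν (r⁻¹ * ‖x‖) := Set.indicator_of_mem (s := Set.Ici A) hAx ν
      simp only [hg, hB, hνAx]
      split_ifs with h1
      · have hp := (hA _ hAx ‖x‖⁻¹ ((one_le_inv₀ hx0).2 h1.le)).2
        have e1 : ‖x‖⁻¹ * (r⁻¹ * ‖x‖) = r⁻¹ := by field_simp
        rw [e1] at hp
        have hp' : ν (r⁻¹ * ‖x‖) / ν r⁻¹ ≤ M * ‖x‖⁻¹ ^ (β + δ) := by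
          rw [div_le_iff₀ hνr]; exact hp
        have e2 : ‖x‖ ^ (2 - β - δ) = ‖x‖ ^ 2 * ‖x‖⁻¹ ^ (β + δ) := by
          rw [Real.inv_rpow hx0.le, ← Real.rpow_neg hx0.le, ← Real.rpow_natCast ‖x‖ 2,
            ← Real.rpow_add hx0]
          congr 1
          push_cast
          ring
        rw [e2]
        calc (1 - Real.cos ⟪e, x⟫) * (ν (r⁻¹ * ‖x‖) / ν r⁻¹)
            ≤ (3 * ‖x‖ ^ 2) * (M * ‖x‖⁻¹ ^ (β + δ)) := by
              refine mul_le_mul ?_ hp' (div_nonneg (hν_pos _ (by positivity)).le hνr.le)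
                (by positivity)
              refine hcos.trans ?_
              have := min_le_left (‖x‖ ^ 2) 1
              linarith
          _ = _ := by ring
      · have hp := (hA _ hrA' ‖x‖ (not_lt.1 h1)).1
        rw [mul_comm ‖x‖ r⁻¹] at hp
        have hp' : ν (r⁻¹ * ‖x‖) / ν r⁻¹ ≤ M * ‖x‖ ^ (-(β - δ)) := by
          rw [div_le_iff₀ hνr]; exact hp
        calc (1 - Real.cos ⟪e, x⟫) * (ν (r⁻¹ * ‖x‖) / ν r⁻¹)
            ≤ 3 * (M * ‖x‖ ^ (-(β - δ))) := by
              refine mul_le_mul ?_ hp' (div_nonneg (hν_pos _ (by positivity)).le hνr.le)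
                (by positivity)
              refine hcos.trans ?_
              have := min_le_right (‖x‖ ^ 2) 1
              linarith
          _ = _ := by ring
    · have hνAx : νA (r⁻¹ * ‖x‖) = 0 := Set.indicator_of_notMem (s := Set.Ici A) hAx ν
      simp only [hg, hνAx, zero_div, mul_zero]
      simp only [hB]
      split_ifs <;> positivity
  have hglim : ∀ x : V, x ≠ 0 →
      Tendsto (fun r => g r x) (𝓝[>] 0) (𝓝 ((1 - Real.cos ⟪e, x⟫) * ‖x‖ ^ (-β))) := by
    intro x hx
    have hx0 : 0 < ‖x‖ := norm_pos_iff.2 hx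
    refine Tendsto.const_mul _ ?_
    refine ((hrv ‖x‖ hx0).comp tendsto_inv_nhdsGT_zero).congr' ?_
    have h1 : Tendsto (fun r : ℝ => r⁻¹ * ‖x‖) (𝓝[>] 0) atTop :=
      tendsto_inv_nhdsGT_zero.atTop_mul_const hx0
    filter_upwards [h1.eventually_ge_atTop A] with r hr
    rw [Function.comp_apply, hνA, Set.indicator_of_mem (s := Set.Ici A) hr, mul_comm ‖x‖]
  have hae : ∀ᵐ x : V, x ≠ 0 := Measure.ae_ne volume 0
  have hsmall : ∀ᶠ r : ℝ in 𝓝[>] 0, 0 < r ∧ r < A⁻¹ := Ioo_mem_nhdsGT (inv_pos.2 hA0)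
  set C : ℝ := ∫ x : V, (1 - Real.cos ⟪e, x⟫) * ‖x‖ ^ (-β) with hC
  have hgC : Tendsto (fun r => ∫ x, g r x) (𝓝[>] 0) (𝓝 C) := by
    refine tendsto_integral_filter_of_dominated_convergence B ?_ ?_ hBint ?_
    · filter_upwards [self_mem_nhdsWithin] with r (hr : 0 < r)
      exact (Continuous.aestronglyMeasurable (by fun_prop)).mul
        ((aestronglyMeasurable_comp_mul_norm hνAexp (inv_pos.2 hr)).aemeasurable.div_const
          _).aestronglyMeasurable
    · filter_upwards [hsmall] with r hr
      filter_upwards [hae] with x hx using hgbound r hr.1 hr.2 x hx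
    · filter_upwards [hae] with x hx using hglim x hx
  have hCpos : 0 < C := by
    refine integral_one_sub_cos_mul_pos (w := fun x : V => ‖x‖ ^ (-β))
      (fun z hz => Real.rpow_pos_of_pos (norm_pos_iff.2 hz) _)
      (norm_ne_zero_iff.1 (by rw [he]; exact one_ne_zero)) ?_
    refine hBint.mono' ?_ ?_
    · exact (Continuous.aestronglyMeasurable (by fun_prop)).mul
        (measurable_norm.pow_const _).aestronglyMeasurable
    · filter_upwards [hae] with x hx
      refine le_of_tendsto (hglim x hx).norm ?_
      filter_upwards [hsmall] with r hr using hgbound r hr.1 hr.2 x hx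
  -- the part of the Lévy measure inside the ball of radius `A` is negligible
  set I : ℝ := ∫ z : V, min (‖z‖ ^ 2) 1 * ν ‖z‖ with hI
  have hνAint : ∀ ξ : V, Integrable fun z : V => (1 - Real.cos ⟪ξ, z⟫) * νA ‖z‖ := by
    refine integrable_one_sub_cos_mul (fun z _ => hνA0 _) (hint.mono' ?_ ?_)
    · have := aestronglyMeasurable_comp_mul_norm (V := V) hνAexp one_pos
      simp only [one_mul] at this
      exact (Continuous.aestronglyMeasurable (by fun_prop)).mul this
    · filter_upwards [hae] with z hz
      rw [Real.norm_of_nonneg (mul_nonneg (by positivity) (hνA0 _))]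
      exact mul_le_mul_of_nonneg_left (hνAle z hz) (by positivity)
  have hψint : ∀ ξ : V, Integrable fun z : V => (1 - Real.cos ⟪ξ, z⟫) * ν ‖z‖ :=
    integrable_one_sub_cos_mul (fun z hz => (hνpos' z hz).le) hint
  have hdiff : ∀ r, 0 < r → 0 ≤ (∫ z, (1 - Real.cos ⟪r • e, z⟫) * ν ‖z‖) - J r ∧
      (∫ z, (1 - Real.cos ⟪r • e, z⟫) * ν ‖z‖) - J r ≤ r ^ 2 * A ^ 2 * I := by
    intro r hr
    simp only [hJ]
    rw [← integral_sub (hψint _) (hνAint _)]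
    constructor
    · refine integral_nonneg_of_ae ?_
      filter_upwards [hae] with z hz
      rw [← mul_sub]
      exact mul_nonneg (one_sub_cos_nonneg _) (sub_nonneg.2 (hνAle z hz))
    · rw [hI, ← integral_const_mul]
      refine integral_mono_ae ((hψint _).sub (hνAint _)) (hint.const_mul _) ?_
      filter_upwards [hae] with z hz
      have hz' := hνpos' z hz
      rw [← mul_sub]
      by_cases hAz : A ≤ ‖z‖
      · rw [hνA, Set.indicator_of_mem (s := Set.Ici A) hAz, sub_self, mul_zero]
        positivity
      · rw [hνA, Set.indicator_of_notMem (s := Set.Ici A) hAz, sub_zero, ← mul_assoc]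
        refine mul_le_mul_of_nonneg_right ((one_sub_cos_inner_le_sq _ _).trans ?_) hz'.le
        rw [norm_smul, he, mul_one, Real.norm_of_nonneg hr.le, mul_assoc]
        refine mul_le_mul_of_nonneg_left ?_ (sq_nonneg r)
        rw [mul_min_of_nonneg _ _ (sq_nonneg A), mul_one]
        refine le_min ?_ ?_
        · exact le_mul_of_one_le_left (sq_nonneg _) (one_le_pow₀ hA1)
        · gcongr
          exact (not_le.1 hAz).le
  have hI0 : 0 ≤ I := integral_nonneg_of_ae (by
    filter_upwards [hae] with z hz
    exact mul_nonneg (by positivity) (hνpos' z hz).le)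
  have hrest : Tendsto (fun r => ((∫ z, (1 - Real.cos ⟪r • e, z⟫) * ν ‖z‖) - J r) *
      (r ^ n / ν r⁻¹)) (𝓝[>] 0) (𝓝 0) := by
    have hνA' := hν_pos A hA0
    set D : ℝ := A ^ 2 * I * (M / ν A) * A⁻¹ ^ (β + δ) with hD
    have hlim : Tendsto (fun r : ℝ => D * r ^ (2 - α - δ)) (𝓝[>] 0) (𝓝 0) := by
      have hc : ContinuousAt (fun r : ℝ => D * r ^ (2 - α - δ)) 0 :=
        (Real.continuousAt_rpow_const _ _ (Or.inr (by linarith))).const_mul _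
      have := hc.tendsto.mono_left (nhdsWithin_le_nhds (s := Set.Ioi 0))
      simpa [Real.zero_rpow (by linarith : 2 - α - δ ≠ 0)] using this
    refine tendsto_of_tendsto_of_tendsto_of_le_of_le' tendsto_const_nhds hlim ?_ ?_
    · filter_upwards [self_mem_nhdsWithin] with r (hr : 0 < r)
      have := hν_pos r⁻¹ (by positivity)
      exact mul_nonneg (hdiff r hr).1 (by positivity)
    · filter_upwards [hsmall] with r hr
      have hr0 := hr.1
      have hνr := hν_pos r⁻¹ (by positivity)
      have hρ : 1 ≤ r⁻¹ * A⁻¹ := by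
        rw [← mul_inv, one_le_inv₀ (by positivity)]
        have := hr.2
        rw [lt_inv_comm₀ hr0 hA0] at this
        calc r * A ≤ r * r⁻¹ := by gcongr
          _ = 1 := mul_inv_cancel₀ hr0.ne'
      have hp := (hA A le_rfl _ hρ).2
      rw [mul_assoc r⁻¹, inv_mul_cancel₀ hA0.ne', mul_one,
        Real.mul_rpow (by positivity) (by positivity)] at hp
      have hp' : (ν r⁻¹)⁻¹ ≤ M / ν A * (r⁻¹ ^ (β + δ) * A⁻¹ ^ (β + δ)) := by
        rw [inv_le_iff_one_le_mul₀ hνr, div_mul_eq_mul_div, div_mul_eq_mul_div,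
          one_le_div₀ hνA']
        exact hp
      have e2 : r ^ (2 - α - δ) = r ^ 2 * r ^ n * r⁻¹ ^ (β + δ) := by
        rw [Real.inv_rpow hr0.le, ← Real.rpow_neg hr0.le, ← Real.rpow_natCast r 2,
          ← Real.rpow_natCast r n, ← Real.rpow_add hr0, ← Real.rpow_add hr0]
        congr 1
        rw [hβ]
        push_cast
        ring
      calc _ ≤ (r ^ 2 * A ^ 2 * I) *
            (r ^ n * (M / ν A * (r⁻¹ ^ (β + δ) * A⁻¹ ^ (β + δ)))) := by
            rw [div_eq_mul_inv (r ^ n)]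
            gcongr
            exact (hdiff r hr0).2
        _ = _ := by rw [e2, hD]; ring
  refine ⟨C, hCpos, ?_⟩
  have hsum := hrest.add hgC
  rw [zero_add] at hsum
  refine hsum.congr' ?_
  filter_upwards [self_mem_nhdsWithin] with r (hr : 0 < r)
  rw [← hJg r hr]
  ring

end ExponentAsymptotics

section RegularVariation

variable {ν φ : ℝ → ℝ} {n : ℕ} {C α : ℝ}

lemma tendsto_comp_mul_div_of_regularlyVarying (hν_pos : ∀ r : ℝ, 0 < r → 0 < ν r)
    (hrv : ∀ lam : ℝ, 0 < lam → Tendsto (fun r : ℝ => ν (lam * r) / ν r) atTop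
      (𝓝 (lam ^ (-(n : ℝ) - α)))) (hC : 0 < C)
    (hφ : Tendsto (fun r : ℝ => φ r * (r ^ n / ν r⁻¹)) (𝓝[>] 0) (𝓝 C)) {c : ℝ} (hc : 0 < c) :
    Tendsto (fun r => φ (c * r) / φ r) (𝓝[>] 0) (𝓝 (c ^ α)) := by
  have hcr : Tendsto (fun r : ℝ => c * r) (𝓝[>] 0) (𝓝[>] 0) := by
    refine tendsto_nhdsWithin_iff.2 ⟨?_, ?_⟩
    · have : Tendsto (fun r : ℝ => c * r) (𝓝 0) (𝓝 (c * 0)) := tendsto_id.const_mul c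
      rw [mul_zero] at this
      exact this.mono_left nhdsWithin_le_nhds
    · filter_upwards [self_mem_nhdsWithin] with r (hr : 0 < r) using mul_pos hc hr
  have h := (((hφ.comp hcr).div hφ hC.ne').mul
    ((hrv c⁻¹ (inv_pos.2 hc)).comp tendsto_inv_nhdsGT_zero)).mul_const (c ^ n)⁻¹
  have hlim : C / C * c⁻¹ ^ (-(n : ℝ) - α) * (c ^ n)⁻¹ = c ^ α := by
    rw [div_self hC.ne', one_mul, Real.inv_rpow hc.le, ← Real.rpow_neg hc.le,
      ← Real.rpow_natCast, ← Real.rpow_neg hc.le, ← Real.rpow_add hc]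
    congr 1
    ring
  rw [hlim] at h
  refine h.congr' ?_
  filter_upwards [self_mem_nhdsWithin] with r (hr : 0 < r)
  have h1 := hν_pos r⁻¹ (inv_pos.2 hr)
  have h2 := hν_pos (c⁻¹ * r⁻¹) (by positivity)
  simp only [Function.comp_apply, Pi.div_apply, mul_inv, mul_pow]
  generalize ν (c⁻¹ * r⁻¹) = a at h2 ⊢
  generalize ν r⁻¹ = b at h1 ⊢
  by_cases h0 : φ r = 0
  · simp [h0]
  · field_simp

lemma exists_rpow_mul_le_of_regularlyVarying (hν_pos : ∀ r : ℝ, 0 < r → 0 < ν r)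
    (hν_mono : ∀ r₁ r₂ : ℝ, 0 < r₁ → r₁ ≤ r₂ → ν r₂ ≤ ν r₁) (hα : 0 < α)
    (hrv : ∀ lam : ℝ, 0 < lam → Tendsto (fun r : ℝ => ν (lam * r) / ν r) atTop
      (𝓝 (lam ^ (-(n : ℝ) - α)))) (hC : 0 < C)
    (hφ : Tendsto (fun r : ℝ => φ r * (r ^ n / ν r⁻¹)) (𝓝[>] 0) (𝓝 C)) :
    ∃ r₀ > 0, ∃ c > 0, ∀ R : ℝ, 0 < R → ∀ ρ : ℝ, 1 ≤ ρ → ρ * R ≤ r₀ →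
      c * ρ ^ (α / 2) * φ R ≤ φ (ρ * R) := by
  set β : ℝ := n + α with hβ
  have hn0 : (0 : ℝ) ≤ n := Nat.cast_nonneg n
  obtain ⟨A, hA1, hA⟩ := exists_potter_bounds hν_pos hν_mono (half_pos hα)
    (by linarith : α / 2 < β) (by
      have := hrv 2 two_pos
      rwa [show -(n : ℝ) - α = -β by rw [hβ]; ring] at this)
  have hA0 : 0 < A := by linarith
  set M : ℝ := 2 ^ (β + α / 2) with hM
  have hM0 : 0 < M := by positivity
  have hev := (hφ.eventually (lt_mem_nhds (half_lt_self hC))).and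
    (hφ.eventually (gt_mem_nhds (lt_two_mul_self hC)))
  obtain ⟨r₁, hr₁, hr₁'⟩ := mem_nhdsGT_iff_exists_Ioc_subset.1 hev
  have hr₁ : 0 < r₁ := hr₁
  refine ⟨min r₁ A⁻¹, by positivity, (4 * M)⁻¹, by positivity, ?_⟩
  intro R hR ρ hρ hρR
  have hρ0 : 0 < ρ := by linarith
  have hRρ : R ≤ ρ * R := le_mul_of_one_le_left hR.le hρ
  have hρR1 : ρ * R ≤ r₁ := hρR.trans (min_le_left _ _)
  have hρRA : A ≤ (ρ * R)⁻¹ := by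
    rw [le_inv_comm₀ hA0 (by positivity)]
    exact hρR.trans (min_le_right _ _)
  have hup := (hr₁' ⟨hR, hRρ.trans hρR1⟩).2
  have hlow := (hr₁' ⟨mul_pos hρ0 hR, hρR1⟩).1
  have h1 := hν_pos R⁻¹ (inv_pos.2 hR)
  have h2 := hν_pos (ρ * R)⁻¹ (by positivity)
  have hp := (hA _ hρRA ρ hρ).1
  have e1 : ρ * (ρ * R)⁻¹ = R⁻¹ := by field_simp
  rw [e1] at hp
  rw [← mul_div_assoc, div_lt_iff₀ h1] at hup
  rw [← mul_div_assoc, lt_div_iff₀ h2] at hlow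
  have e2 : ρ ^ n * ρ ^ (α / 2) * ρ ^ (-(β - α / 2)) = 1 := by
    rw [← Real.rpow_natCast, ← Real.rpow_add hρ0, ← Real.rpow_add hρ0, hβ]
    convert Real.rpow_zero ρ using 2
    ring
  have hRn : 0 < R ^ n := by positivity
  have key : (4 * M)⁻¹ * ρ ^ (α / 2) * φ R * (ρ ^ n * R ^ n) ≤ φ (ρ * R) * (ρ ^ n * R ^ n) := by
    calc (4 * M)⁻¹ * ρ ^ (α / 2) * φ R * (ρ ^ n * R ^ n)
        = (4 * M)⁻¹ * (ρ ^ n * ρ ^ (α / 2)) * (φ R * R ^ n) := by ring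
      _ ≤ (4 * M)⁻¹ * (ρ ^ n * ρ ^ (α / 2)) *
          (2 * C * (M * ρ ^ (-(β - α / 2)) * ν (ρ * R)⁻¹)) := by
          refine mul_le_mul_of_nonneg_left ?_ (by positivity)
          exact hup.le.trans (mul_le_mul_of_nonneg_left hp (by positivity))
      _ = C / 2 * ν (ρ * R)⁻¹ * (ρ ^ n * ρ ^ (α / 2) * ρ ^ (-(β - α / 2))) := by
          field_simp
          ring
      _ = C / 2 * ν (ρ * R)⁻¹ := by rw [e2, mul_one]
      _ ≤ φ (ρ * R) * (ρ * R) ^ n := hlow.le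
      _ = _ := by rw [mul_pow]
  exact le_of_mul_le_mul_right key (by positivity)

end RegularVariation

section GeneralizedInverse

lemma exists_isGreatest_runningSup_eq {φ : ℝ → ℝ} (hφ : Continuous φ) {u : ℝ} (h0 : φ 0 < u)
    (hU : ∃ ρ, 0 ≤ ρ ∧ u < φ ρ) :
    ∃ R, 0 < R ∧ IsGreatest {r : ℝ | 0 ≤ r ∧ sSup (φ '' Set.Icc 0 r) = u} R ∧ φ R = u ∧
      ∀ ε, 0 ≤ ε → u < φ ε → R ≤ ε := by
  set U : Set ℝ := {ρ | 0 ≤ ρ ∧ u < φ ρ} with hUdef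
  have hbdd : BddBelow U := ⟨0, fun ρ hρ => hρ.1⟩
  have hmem : sInf U ∈ {ρ : ℝ | 0 ≤ ρ ∧ u ≤ φ ρ} := by
    refine closure_minimal (t := {ρ : ℝ | 0 ≤ ρ ∧ u ≤ φ ρ}) (fun ρ hρ => ⟨hρ.1, hρ.2.le⟩) ?_
      (csInf_mem_closure hU hbdd)
    exact (isClosed_le continuous_const continuous_id).inter (isClosed_le continuous_const hφ)
  set R := sInf U with hR
  have hR0 : 0 < R := by
    refine lt_of_le_of_ne hmem.1 fun h => ?_
    have := hmem.2
    rw [← h] at this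
    linarith
  have hlt : ∀ ρ, 0 ≤ ρ → ρ < R → φ ρ ≤ u := fun ρ hρ hρR =>
    not_lt.1 fun h => notMem_of_lt_csInf hρR hbdd ⟨hρ, h⟩
  have hRu : φ R = u := by
    refine le_antisymm ?_ hmem.2
    refine le_of_tendsto (hφ.continuousAt.tendsto.mono_left (nhdsWithin_le_nhds (s := Set.Iio R))) ?_
    filter_upwards [Ioo_mem_nhdsLT hR0] with ρ hρ using hlt ρ hρ.1.le hρ.2
  have hsup : ∀ r, BddAbove (φ '' Set.Icc 0 r) := fun r =>
    (isCompact_Icc.image hφ).bddAbove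
  refine ⟨R, hR0, ⟨⟨hR0.le, ?_⟩, ?_⟩, hRu, fun ε hε hu => csInf_le hbdd ⟨hε, hu⟩⟩
  · refine IsGreatest.csSup_eq ⟨⟨R, ⟨hR0.le, le_rfl⟩, hRu⟩, ?_⟩
    rintro _ ⟨ρ, hρ, rfl⟩
    rcases hρ.2.lt_or_eq with h | h
    · exact hlt ρ hρ.1 h
    · rw [h, hRu]
  · rintro r ⟨_, hr⟩
    by_contra! h
    obtain ⟨ρ, hρ, hρr⟩ := exists_lt_of_csInf_lt hU h
    have := le_csSup (hsup r) ⟨ρ, ⟨hρ.1, hρr.le⟩, rfl⟩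
    rw [hr] at this
    exact hρ.2.not_ge this

variable {d : ℕ} {ν : ℝ → ℝ}

lemma ψ_eq_of_norm_eq {ξ η : EuclideanSpace ℝ (Fin d)} (h : ‖ξ‖ = ‖η‖) : ψ d ν ξ = ψ d ν η :=
  integral_one_sub_cos_mul_radial ν h

lemma ψ_zero : ψ d ν 0 = 0 := by
  simp [ψ]

lemma ψ_norm_smul {e : EuclideanSpace ℝ (Fin d)} (he : ‖e‖ = 1) (ξ : EuclideanSpace ℝ (Fin d)) :
    ψ d ν (‖ξ‖ • e) = ψ d ν ξ :=
  ψ_eq_of_norm_eq (by rw [norm_smul, he, norm_norm, mul_one])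

lemma ψstar_eq {e : EuclideanSpace ℝ (Fin d)} (he : ‖e‖ = 1) (r : ℝ) :
    ψstar d ν r = sSup ((fun ρ : ℝ => ψ d ν (ρ • e)) '' Set.Icc 0 r) := by
  rw [ψstar]
  congr 1
  ext y
  constructor
  · rintro ⟨z, hz, rfl⟩
    exact ⟨‖z‖, ⟨norm_nonneg z, hz⟩, ψ_norm_smul he z⟩
  · rintro ⟨ρ, hρ, rfl⟩
    exact ⟨ρ • e, by rw [norm_smul, he, mul_one, Real.norm_of_nonneg hρ.1]; exact hρ.2, rfl⟩

/-- For small levels `u` the generalized inverse is a genuine right inverse of `ψ`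
along any ray. -/
lemma ψinv_spec {e : EuclideanSpace ℝ (Fin d)} (he : ‖e‖ = 1) (hψ : Continuous (ψ d ν)) {u : ℝ}
    (hu : 0 < u) {ε : ℝ} (hε : 0 ≤ ε) (hεu : u < ψ d ν (ε • e)) :
    0 < ψinv d ν u ∧ ψ d ν (ψinv d ν u • e) = u ∧ ψinv d ν u ≤ ε := by
  have hcont : Continuous fun ρ : ℝ => ψ d ν (ρ • e) := hψ.comp (by fun_prop)
  obtain ⟨R, hR0, hRg, hRu, hRε⟩ := exists_isGreatest_runningSup_eq hcont
    (by rwa [zero_smul, ψ_zero]) ⟨ε, hε, hεu⟩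
  have : ψinv d ν u = R := by
    rw [ψinv]
    simp only [ψstar_eq he]
    exact hRg.csSup_eq
  rw [this]
  exact ⟨hR0, hRu, hRε ε hε hεu⟩

lemma tendsto_ψinv_one_div {e : EuclideanSpace ℝ (Fin d)} (he : ‖e‖ = 1)
    (hψ : Continuous (ψ d ν)) (hpos : ∀ ξ, ξ ≠ 0 → 0 < ψ d ν ξ) :
    (∀ᶠ s : ℝ in atTop, 0 < ψinv d ν (1 / s) ∧ ψ d ν (ψinv d ν (1 / s) • e) = 1 / s) ∧
      Tendsto (fun s : ℝ => ψinv d ν (1 / s)) atTop (𝓝[>] 0) := by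
  have hinv : Tendsto (fun s : ℝ => 1 / s) atTop (𝓝 0) := by
    simpa using tendsto_inv_atTop_zero (𝕜 := ℝ)
  have hev : ∀ ε : ℝ, 0 < ε → ∀ᶠ s : ℝ in atTop, 0 < ψinv d ν (1 / s) ∧
      ψ d ν (ψinv d ν (1 / s) • e) = 1 / s ∧ ψinv d ν (1 / s) ≤ ε := by
    intro ε hε
    have h1 : 0 < ψ d ν (ε • e) := by
      refine hpos _ (smul_ne_zero hε.ne' ?_)
      rintro rfl
      simp at he
    filter_upwards [eventually_gt_atTop 0, hinv.eventually (gt_mem_nhds h1)] with s hs hsε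
    exact ψinv_spec he hψ (by positivity) hε.le hsε
  refine ⟨(hev 1 one_pos).mono fun s hs => ⟨hs.1, hs.2.1⟩, tendsto_nhdsWithin_iff.2 ⟨?_, ?_⟩⟩
  · refine Metric.tendsto_nhds.2 fun ε hε => ?_
    filter_upwards [hev (ε / 2) (half_pos hε)] with s hs
    rw [Real.dist_eq, sub_zero, abs_of_pos hs.1]
    linarith [hs.2.2]
  · exact (hev 1 one_pos).mono fun s hs => hs.1

end GeneralizedInverse

section ScalingLimit

variable {V : Type*} [NormedAddCommGroup V] [InnerProductSpace ℝ V] [FiniteDimensional ℝ V]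
  [MeasurableSpace V] [BorelSpace V]

lemma integrable_exp_neg_mul_rpow_norm [Nontrivial V] {a κ : ℝ} (ha : 0 < a) (hκ : 0 < κ) :
    Integrable fun ξ : V => Real.exp (-(a * ‖ξ‖ ^ κ)) := by
  refine (integrable_fun_norm_addHaar volume (f := fun y : ℝ => Real.exp (-(a * y ^ κ)))).2 ?_
  have hn : 1 ≤ Module.finrank ℝ V := Module.finrank_pos
  have hs : (-1 : ℝ) < (Module.finrank ℝ V - 1 : ℕ) :=
    lt_of_lt_of_le (by norm_num) (Nat.cast_nonneg _)
  refine (integrableOn_rpow_mul_exp_neg_mul_rpow hs hκ ha).congr_fun (fun y _ => ?_)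
    measurableSet_Ioi
  simp only [smul_eq_mul, Real.rpow_natCast, neg_mul]

/-- Rescaled exponentials of a radial symbol which is regularly varying at the origin converge
in `L¹` to the exponential of the stable symbol. -/
theorem tendsto_integral_abs_exp_rescaled_sub [Nontrivial V] {Ψ : V → ℝ} {φ : ℝ → ℝ}
    (hΨ : Continuous Ψ) (hΨ00 : Ψ 0 = 0) (hΨ0 : ∀ ξ, 0 ≤ Ψ ξ) (hφ : ∀ ξ, φ ‖ξ‖ = Ψ ξ)
    {α κ r₀ c c₁ t₀ : ℝ} (hα : 0 < α) (hκ : 0 < κ) (hr₀ : 0 < r₀) (hc : 0 < c) (hc₁ : 0 < c₁)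
    (hreg : ∀ a : ℝ, 0 < a → Tendsto (fun r => φ (a * r) / φ r) (𝓝[>] 0) (𝓝 (a ^ α)))
    (hlow : ∀ R : ℝ, 0 < R → ∀ ρ : ℝ, 1 ≤ ρ → ρ * R ≤ r₀ → c * ρ ^ κ * φ R ≤ φ (ρ * R))
    (htail : ∀ ξ : V, r₀ ≤ ‖ξ‖ → c₁ ≤ Ψ ξ)
    (hint : Integrable fun ξ => Real.exp (-(t₀ * Ψ ξ))) {R : ℝ → ℝ}
    (hR : Tendsto R atTop (𝓝[>] 0)) (hφR : ∀ᶠ s in atTop, φ (R s) = 1 / s) {t : ℝ} (ht : 0 < t) :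
    Tendsto (fun s => ∫ ξ : V, |Real.exp (-(t * (s * Ψ (R s • ξ)))) - Real.exp (-(t * ‖ξ‖ ^ α))|)
      atTop (𝓝 0) := by
  set n := Module.finrank ℝ V with hn
  set F : ℝ → V → ℝ := fun s ξ => Real.exp (-(t * (s * Ψ (R s • ξ)))) with hF
  set G : V → ℝ := fun ξ => Real.exp (-(t * ‖ξ‖ ^ α)) with hG
  have hGint : Integrable G := integrable_exp_neg_mul_rpow_norm ht hα
  have hFc : ∀ s, Continuous (F s) := fun s => by
    have := hΨ.comp (continuous_const_smul (R s))
    simp only [Function.comp_def] at this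
    fun_prop
  have hRpos : ∀ᶠ s in atTop, 0 < R s := hR.eventually self_mem_nhdsWithin
  have hR0 : Tendsto R atTop (𝓝 0) := hR.mono_right nhdsWithin_le_nhds
  have hsmul : ∀ s ξ, 0 < R s → Ψ (R s • ξ) = φ (‖ξ‖ * R s) := fun s ξ hs => by
    rw [← hφ, norm_smul, Real.norm_of_nonneg hs.le, mul_comm]
  have hFG : ∀ ξ, Tendsto (fun s => F s ξ) atTop (𝓝 (G ξ)) := by
    intro ξ
    refine (Real.continuous_exp.tendsto _).comp (Tendsto.neg (Tendsto.const_mul t ?_))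
    rcases eq_or_ne ξ 0 with rfl | hξ
    · simp [hΨ00, Real.zero_rpow hα.ne']
    · refine ((hreg ‖ξ‖ (norm_pos_iff.2 hξ)).comp hR).congr' ?_
      filter_upwards [hRpos, hφR] with s hs hs'
      rw [Function.comp_apply, hs', hsmul s ξ hs, one_div, div_inv_eq_mul, mul_comm]
  set S : ℝ → Set V := fun s => {ξ | R s * ‖ξ‖ ≤ r₀} with hS
  have hSm : ∀ s, MeasurableSet (S s) := fun s =>
    measurableSet_le (measurable_const.mul measurable_norm) measurable_const
  set B : V → ℝ := fun ξ => Real.exp (t * c) * Real.exp (-(t * c * ‖ξ‖ ^ κ)) with hB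
  have hBint : Integrable B := (integrable_exp_neg_mul_rpow_norm (by positivity) hκ).const_mul _
  have hFB : ∀ᶠ s in atTop, ∀ ξ ∈ S s, F s ξ ≤ B ξ := by
    filter_upwards [hRpos, hφR, eventually_gt_atTop 0] with s hs hs' hs0 ξ hξ
    simp only [hF, hB]
    rw [← Real.exp_add, Real.exp_le_exp]
    rcases le_total 1 ‖ξ‖ with h1 | h1
    · have := hlow (R s) hs ‖ξ‖ h1 (by rw [mul_comm]; exact hξ)
      rw [hs', ← hsmul s ξ hs] at this
      have h2 : c * ‖ξ‖ ^ κ ≤ s * Ψ (R s • ξ) := by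
        rw [mul_one_div, div_le_iff₀ hs0] at this
        linarith
      have := mul_le_mul_of_nonneg_left h2 ht.le
      nlinarith [mul_pos ht hc]
    · have h2 : ‖ξ‖ ^ κ ≤ 1 := Real.rpow_le_one (norm_nonneg _) h1 hκ.le
      have h3 : 0 ≤ t * (s * Ψ (R s • ξ)) := by
        have := hΨ0 (R s • ξ)
        positivity
      have := mul_le_mul_of_nonneg_left h2 (mul_pos ht hc).le
      linarith
  -- the bulk
  have hbulk : Tendsto (fun s => ∫ ξ, |(S s).indicator (F s) ξ - G ξ|) atTop (𝓝 0) := by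
    have h := tendsto_integral_filter_of_dominated_convergence (μ := (volume : Measure V))
      (F := fun s ξ => |(S s).indicator (F s) ξ - G ξ|) (f := fun _ => (0 : ℝ)) (l := atTop)
      (fun ξ => B ξ + G ξ) ?_ ?_ (hBint.add hGint) ?_
    · simpa using h
    · exact Eventually.of_forall fun s =>
        (((hFc s).aestronglyMeasurable.indicator (hSm s)).sub hGint.1).norm
    · filter_upwards [hFB] with s hs
      refine Eventually.of_forall fun ξ => ?_
      rw [Real.norm_of_nonneg (abs_nonneg _)]
      refine (abs_sub _ _).trans (add_le_add ?_ (abs_of_pos (Real.exp_pos _)).le)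
      by_cases h : ξ ∈ S s
      · rw [Set.indicator_of_mem h, abs_of_pos (Real.exp_pos _)]
        exact hs ξ h
      · rw [Set.indicator_of_notMem h, abs_zero]
        positivity
    · refine Eventually.of_forall fun ξ => ?_
      have h1 : Tendsto (fun s => (S s).indicator (F s) ξ) atTop (𝓝 (G ξ)) := by
        refine (hFG ξ).congr' ?_
        have h2 : Tendsto (fun s => R s * ‖ξ‖) atTop (𝓝 0) := by
          simpa using hR0.mul_const ‖ξ‖
        filter_upwards [h2.eventually (gt_mem_nhds hr₀)] with s hs
        exact (Set.indicator_of_mem (s := S s) (show R s * ‖ξ‖ ≤ r₀ from hs.le) _).symm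
      simpa using (h1.sub_const (G ξ)).abs
  -- the tail
  set I₀ : ℝ := ∫ ξ : V, Real.exp (-(t₀ * Ψ ξ)) with hI₀
  have hI₀0 : 0 ≤ I₀ := integral_nonneg fun _ => (Real.exp_pos _).le
  obtain ⟨e, he⟩ := exists_norm_eq V hr₀.le
  set T : ℝ → V → ℝ := fun s ξ => Real.exp (-((t * s - t₀) * c₁)) *
    Real.exp (-(t₀ * Ψ (R s • ξ))) with hT
  have hTint : ∀ s, 0 < R s → Integrable (T s) := fun s hs =>
    (hint.comp_smul hs.ne').const_mul _
  have hTval : ∀ s, 0 < R s → ∫ ξ, T s ξ =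
      Real.exp (-((t * s - t₀) * c₁)) * ((R s ^ n)⁻¹ * I₀) := by
    intro s hs
    have h := Measure.integral_comp_smul_of_nonneg (volume : Measure V)
      (fun ξ => Real.exp (-(t₀ * Ψ ξ))) (R s) (hR := hs.le)
    simp only [hT]
    rw [integral_const_mul, h, smul_eq_mul]
  have hFT : ∀ s, 0 < R s → t₀ / t ≤ s → ∀ ξ, ξ ∉ S s → F s ξ ≤ T s ξ := by
    intro s hs hst ξ hξ
    have h1 : c₁ ≤ Ψ (R s • ξ) := by
      refine htail _ ?_
      rw [norm_smul, Real.norm_of_nonneg hs.le]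
      exact (not_le.1 hξ).le
    rw [div_le_iff₀ ht] at hst
    simp only [hF, hT]
    rw [← Real.exp_add, Real.exp_le_exp]
    have := mul_le_mul_of_nonneg_left h1 (by linarith : 0 ≤ t * s - t₀)
    linarith
  set D : ℝ := Real.exp (t₀ * c₁) * I₀ * (((Ψ e / c) ^ κ⁻¹) / r₀) ^ n with hD
  have hTlim : Tendsto (fun s => ∫ ξ, T s ξ) atTop (𝓝 0) := by
    have h0 : Tendsto (fun s : ℝ => D * (s ^ (κ⁻¹ * n) * Real.exp (-(t * c₁) * s))) atTop (𝓝 0) := by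
      simpa using (tendsto_rpow_mul_exp_neg_mul_atTop_nhds_zero (κ⁻¹ * n) (t * c₁)
        (by positivity)).const_mul D
    refine tendsto_of_tendsto_of_tendsto_of_le_of_le' tendsto_const_nhds h0
      (Eventually.of_forall fun s => integral_nonneg fun ξ => by positivity) ?_
    filter_upwards [hRpos, hφR, eventually_gt_atTop 0, hR0.eventually (gt_mem_nhds hr₀)]
      with s hs hs' hs0 hsr
    have h1 := hlow (R s) hs (r₀ / R s) ((one_le_div₀ hs).2 hsr.le)
      (by rw [div_mul_cancel₀ _ hs.ne'])
    rw [div_mul_cancel₀ _ hs.ne', hs', ← he, hφ, he, mul_one_div, div_le_iff₀ hs0] at h1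
    have hq : 0 < r₀ / R s := by positivity
    have hΨe : 0 ≤ Ψ e / c := div_nonneg (hΨ0 e) hc.le
    have h2 : r₀ / R s ≤ (Ψ e / c) ^ κ⁻¹ * s ^ κ⁻¹ := by
      rw [← Real.mul_rpow hΨe hs0.le, Real.le_rpow_inv_iff_of_pos hq.le (by positivity) hκ,
        div_mul_eq_mul_div, le_div_iff₀ hc]
      linarith
    have h3 : (R s ^ n)⁻¹ ≤ ((Ψ e / c) ^ κ⁻¹ / r₀) ^ n * s ^ (κ⁻¹ * n) := by
      rw [Real.rpow_mul hs0.le, Real.rpow_natCast, ← mul_pow, ← inv_pow]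
      gcongr
      rw [div_mul_eq_mul_div, le_div_iff₀ hr₀, inv_mul_eq_div]
      exact h2
    rw [hTval s hs]
    have h4 : Real.exp (-((t * s - t₀) * c₁)) = Real.exp (t₀ * c₁) * Real.exp (-(t * c₁) * s) := by
      rw [← Real.exp_add]
      congr 1
      ring
    rw [h4]
    calc Real.exp (t₀ * c₁) * Real.exp (-(t * c₁) * s) * ((R s ^ n)⁻¹ * I₀)
        ≤ Real.exp (t₀ * c₁) * Real.exp (-(t * c₁) * s) *
          (((Ψ e / c) ^ κ⁻¹ / r₀) ^ n * s ^ (κ⁻¹ * n) * I₀) := by gcongr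
      _ = _ := by rw [hD]; ring
  have hsum := hbulk.add hTlim
  rw [add_zero] at hsum
  refine tendsto_of_tendsto_of_tendsto_of_le_of_le' tendsto_const_nhds hsum
    (Eventually.of_forall fun s => integral_nonneg fun ξ => abs_nonneg _) ?_
  filter_upwards [hRpos, hFB, eventually_ge_atTop (t₀ / t)] with s hs hsB hst
  have hind : Integrable ((S s).indicator (F s)) := by
    refine hBint.mono' ((hFc s).aestronglyMeasurable.indicator (hSm s))
      (Eventually.of_forall fun ξ => ?_)
    by_cases h : ξ ∈ S s
    · rw [Set.indicator_of_mem h, Real.norm_of_nonneg (Real.exp_pos _).le]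
      exact hsB ξ h
    · rw [Set.indicator_of_notMem h, norm_zero]
      positivity
  have hdiff : Integrable fun ξ => |(S s).indicator (F s) ξ - G ξ| := (hind.sub hGint).abs
  rw [← integral_add hdiff (hTint s hs)]
  refine integral_mono_of_nonneg (Eventually.of_forall fun ξ => abs_nonneg _)
    (hdiff.add (hTint s hs)) (Eventually.of_forall fun ξ => ?_)
  simp only
  by_cases h : ξ ∈ S s
  · rw [Set.indicator_of_mem h]
    exact le_add_of_nonneg_right (by positivity)
  · rw [Set.indicator_of_notMem h, zero_sub, abs_neg]
    refine (abs_sub _ _).trans ?_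
    rw [add_comm, abs_of_pos (Real.exp_pos _), abs_of_pos (Real.exp_pos _)]
    exact add_le_add_right (hFT s hs hst ξ h) _

end ScalingLimit

section Scheffe

/-- **Scheffé's lemma**: pointwise convergence of densities of equal mass implies convergence
in `L¹`. -/
theorem tendsto_integral_abs_sub_of_integral_eq {X ι : Type*} [MeasurableSpace X] {μ : Measure X}
    {l : Filter ι} [l.IsCountablyGenerated] {p : ι → X → ℝ} {q : X → ℝ}
    (hp0 : ∀ᶠ i in l, ∀ x, 0 ≤ p i x) (hp : ∀ᶠ i in l, Integrable (p i) μ) (hq : Integrable q μ)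
    (heq : ∀ᶠ i in l, ∫ x, p i x ∂μ = ∫ x, q x ∂μ)
    (hlim : ∀ x, Tendsto (fun i => p i x) l (𝓝 (q x))) :
    Tendsto (fun i => ∫ x, |p i x - q x| ∂μ) l (𝓝 0) := by
  have h : Tendsto (fun i => ∫ x, max (q x - p i x) 0 ∂μ) l (𝓝 0) := by
    have h := tendsto_integral_filter_of_dominated_convergence (μ := μ)
      (F := fun i x => max (q x - p i x) 0) (f := fun _ => (0 : ℝ)) (l := l)
      (fun x => |q x|) ?_ ?_ hq.abs ?_
    · simpa using h
    · filter_upwards [hp] with i hi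
      exact (hq.sub hi).pos_part.aestronglyMeasurable
    · filter_upwards [hp0] with i hi
      refine Eventually.of_forall fun x => ?_
      rw [Real.norm_of_nonneg (le_max_right _ _)]
      exact max_le (by linarith [hi x, le_abs_self (q x)]) (abs_nonneg _)
    · refine Eventually.of_forall fun x => ?_
      simpa using ((hlim x).const_sub (q x)).max (tendsto_const_nhds (x := (0 : ℝ)))
  have h2 := h.const_mul 2
  rw [mul_zero] at h2
  refine h2.congr' ?_
  filter_upwards [hp, heq] with i hi hie
  have hpos : Integrable (fun x => max (q x - p i x) 0) μ := (hq.sub hi).pos_part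
  have hsub : Integrable (fun x => p i x - q x) μ := hi.sub hq
  have habs : ∀ x, |p i x - q x| = (p i x - q x) + 2 * max (q x - p i x) 0 := by
    intro x
    rcases le_total (q x) (p i x) with hx | hx
    · rw [abs_of_nonneg (sub_nonneg.2 hx), max_eq_right (sub_nonpos.2 hx)]
      ring
    · rw [abs_of_nonpos (sub_nonpos.2 hx), max_eq_left (sub_nonneg.2 hx)]
      ring
  simp only [habs]
  rw [integral_add hsub (hpos.const_mul 2), integral_sub hi hq, hie, sub_self, zero_add,
    integral_const_mul]

end Scheffe

section HeatKernels

variable {d : ℕ}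

lemma cosTransform_comp_smul {V : Type*} [NormedAddCommGroup V] [InnerProductSpace ℝ V]
    [FiniteDimensional ℝ V] [MeasurableSpace V] [BorelSpace V] (f : V → ℝ) {R : ℝ} (hR : 0 < R)
    (x : V) : cosTransform (fun ξ => f (R • ξ)) x =
      (R ^ Module.finrank ℝ V)⁻¹ * cosTransform f (R⁻¹ • x) := by
  have h := Measure.integral_comp_smul_of_nonneg (volume : Measure V)
    (fun ξ => Real.cos ⟪ξ, R⁻¹ • x⟫ * f ξ) R (hR := hR.le)
  rw [cosTransform, cosTransform, ← smul_eq_mul, ← h]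
  congr with ξ
  rw [real_inner_smul_left, inner_smul_right, mul_inv_cancel_left₀ hR.ne']

/-- A nonnegative cosine transform of a continuous even function with value `1` at the origin is,
after normalization, a probability density. -/
lemma integrable_and_integral_normalized_cosTransform {f : EuclideanSpace ℝ (Fin d) → ℝ}
    (hf : Integrable f) (hc : Continuous f) (heven : ∀ x, f (-x) = f x) (h0 : f 0 = 1)
    (hpos : ∀ x, 0 ≤ cosTransform f x) :
    Integrable (fun x => ((2 * Real.pi) ^ d)⁻¹ * cosTransform f x) ∧
      ∫ x, ((2 * Real.pi) ^ d)⁻¹ * cosTransform f x = 1 := by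
  obtain ⟨h1, h2⟩ := integrable_cosTransform hf hc heven hpos
  refine ⟨h1.const_mul _, ?_⟩
  rw [integral_const_mul, h2, h0, mul_one, finrank_euclideanSpace_fin]
  exact inv_mul_cancel₀ (by positivity)

end HeatKernels

theorem statement14
    (d : ℕ) (hd : 1 ≤ d) (ν : ℝ → ℝ)
    (hν_pos : ∀ r : ℝ, 0 < r → 0 < ν r)
    (hν_mono : ∀ r₁ r₂ : ℝ, 0 < r₁ → r₁ ≤ r₂ → ν r₂ ≤ ν r₁)
    (hint : Integrable (fun z : EuclideanSpace ℝ (Fin d) => min (‖z‖ ^ 2) 1 * ν ‖z‖))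
    (hninf : ¬ Integrable (fun z : EuclideanSpace ℝ (Fin d) => ν ‖z‖))
    (α : ℝ) (hα : α ∈ Set.Ioo (0:ℝ) 2)
    (hA2 : ∀ lam : ℝ, 0 < lam →
      Tendsto (fun r : ℝ => ν (lam * r) / ν r) atTop (nhds (lam ^ (-(d:ℝ) - α))))
    (t₀ : ℝ) (ht₀ : 0 < t₀)
    (hA3 : Integrable (fun ξ : EuclideanSpace ℝ (Fin d) => Real.exp (-(t₀ * ψ d ν ξ))))
    (hnorm : ∀ ξ : EuclideanSpace ℝ (Fin d), ‖ξ‖ = 1 → ψ d ν ξ = 1)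
:
    ∀ t : ℝ, 0 < t →
      Tendsto (fun s : ℝ =>
          ∫ x : EuclideanSpace ℝ (Fin d), |pts d ν s t x - ptα d α t x|) atTop (nhds 0) ∧
      ∀ A : Set (EuclideanSpace ℝ (Fin d)), MeasurableSet A →
        Tendsto (fun s : ℝ => ∫ x in A, pts d ν s t x) atTop
          (nhds (∫ x in A, ptα d α t x)) := by
  have hd0 : 0 < d := hd
  have : Nontrivial (EuclideanSpace ℝ (Fin d)) :=
    Module.nontrivial_of_finrank_pos (R := ℝ) (by rwa [finrank_euclideanSpace_fin])
  obtain ⟨e, he⟩ := exists_norm_eq (EuclideanSpace ℝ (Fin d)) zero_le_one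
  have hw0 : ∀ z : EuclideanSpace ℝ (Fin d), z ≠ 0 → 0 < ν ‖z‖ := fun z hz =>
    hν_pos _ (norm_pos_iff.2 hz)
  have hw0' : ∀ z : EuclideanSpace ℝ (Fin d), z ≠ 0 → 0 ≤ ν ‖z‖ := fun z hz => (hw0 z hz).le
  have hψint := integrable_one_sub_cos_mul hw0' hint
  have hψc : Continuous (ψ d ν) := continuous_integral_one_sub_cos_mul hw0' hint
  have hψpos : ∀ ξ, ξ ≠ 0 → 0 < ψ d ν ξ := fun ξ hξ =>
    integral_one_sub_cos_mul_pos hw0 hξ (hψint ξ)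
  have hψ0 : ∀ ξ, 0 ≤ ψ d ν ξ := fun ξ => by
    rcases eq_or_ne ξ 0 with rfl | hξ
    · exact ψ_zero.ge
    · exact (hψpos ξ hξ).le
  have hψneg : ∀ ξ, ψ d ν (-ξ) = ψ d ν ξ := fun ξ => ψ_eq_of_norm_eq (norm_neg ξ)
  obtain ⟨C, hC, hCφ⟩ := exists_tendsto_integral_one_sub_cos_mul hν_pos hν_mono hint hα
    (by rw [finrank_euclideanSpace_fin]; exact hA2) he
  rw [finrank_euclideanSpace_fin] at hCφ
  set φ : ℝ → ℝ := fun r => ψ d ν (r • e) with hφ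
  obtain ⟨r₀, hr₀, c, hc, hlow⟩ := exists_rpow_mul_le_of_regularlyVarying (φ := φ) hν_pos hν_mono
    hα.1 hA2 hC hCφ
  obtain ⟨c₁, hc₁, htail⟩ := exists_pos_le_integral_one_sub_cos_mul hw0 hint hr₀
  obtain ⟨hRs, hR⟩ := tendsto_ψinv_one_div he hψc hψpos
  intro t ht
  set f : ℝ → EuclideanSpace ℝ (Fin d) → ℝ := fun s ξ => Real.exp (-(t * ψs d ν s ξ)) with hf
  set g : EuclideanSpace ℝ (Fin d) → ℝ := fun ξ => Real.exp (-(t * ‖ξ‖ ^ α)) with hg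
  have hfg : Tendsto (fun s => ∫ ξ, |f s ξ - g ξ|) atTop (𝓝 0) :=
    tendsto_integral_abs_exp_rescaled_sub hψc ψ_zero hψ0 (ψ_norm_smul he) hα.1 (half_pos hα.1)
      hr₀ hc hc₁
      (fun a ha => tendsto_comp_mul_div_of_regularlyVarying (φ := φ) hν_pos hA2 hC hCφ ha)
      hlow htail hA3 hR (hRs.mono fun s hs => hs.2) ht
  have hexp : ∀ u, t₀ ≤ u → Integrable fun ξ => Real.exp (-(u * ψ d ν ξ)) := fun u hu => by
    refine hA3.mono' (Continuous.aestronglyMeasurable (by fun_prop))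
      (Eventually.of_forall fun ξ => ?_)
    rw [Real.norm_of_nonneg (Real.exp_pos _).le, Real.exp_le_exp, neg_le_neg_iff]
    exact mul_le_mul_of_nonneg_right hu (hψ0 ξ)
  have hfeq : ∀ s, f s = fun ξ => Real.exp (-(t * s * ψ d ν (ψinv d ν (1 / s) • ξ))) := fun s => by
    ext ξ
    simp only [hf, ψs, mul_assoc]
  have hgood : ∀ᶠ s in atTop, 0 < ψinv d ν (1 / s) ∧ t₀ ≤ t * s := by
    filter_upwards [hRs, eventually_ge_atTop (t₀ / t)] with s hs hst
    rw [div_le_iff₀ ht, mul_comm] at hst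
    exact ⟨hs.1, hst⟩
  have hfint : ∀ s, 0 < ψinv d ν (1 / s) → t₀ ≤ t * s → Integrable (f s) := fun s hs hst => by
    rw [hfeq]
    exact (hexp _ hst).comp_smul hs.ne'
  have hfpos : ∀ s, 0 < ψinv d ν (1 / s) → t₀ ≤ t * s → ∀ x, 0 ≤ cosTransform (f s) x := by
    intro s hs hst x
    have h := cosTransform_exp_neg_nonneg hw0' hint hψint hψc (ht₀.le.trans hst) (hexp _ hst)
      ((ψinv d ν (1 / s))⁻¹ • x)
    rw [hfeq, cosTransform_comp_smul (fun ξ => Real.exp (-(t * s * ψ d ν ξ))) hs]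
    exact mul_nonneg (by positivity) h
  have hgint : Integrable g := integrable_exp_neg_mul_rpow_norm ht hα.1
  have hgc : Continuous g := by
    have : Continuous fun ξ : EuclideanSpace ℝ (Fin d) => ‖ξ‖ ^ α :=
      continuous_norm.rpow_const fun _ => Or.inr hα.1.le
    fun_prop
  have hlim : ∀ x, Tendsto (fun s => cosTransform (f s) x) atTop (𝓝 (cosTransform g x)) := by
    intro x
    refine tendsto_iff_dist_tendsto_zero.2 (squeeze_zero' (Eventually.of_forall fun _ =>
      dist_nonneg) ?_ hfg)
    filter_upwards [hgood] with s hs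
    rw [Real.dist_eq]
    exact abs_cosTransform_sub_le (hfint s hs.1 hs.2) hgint x
  have hgpos : ∀ x, 0 ≤ cosTransform g x := fun x =>
    ge_of_tendsto (hlim x) (hgood.mono fun s hs => hfpos s hs.1 hs.2 x)
  obtain ⟨hqint, hq1⟩ := integrable_and_integral_normalized_cosTransform hgint hgc
    (fun ξ => by simp only [hg, norm_neg]) (by simp [hg, Real.zero_rpow hα.1.ne']) hgpos
  have hqint' : Integrable (ptα d α t) := hqint
  have hp : ∀ᶠ s in atTop, (∀ x, 0 ≤ pts d ν s t x) ∧ Integrable (pts d ν s t) ∧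
      ∫ x, pts d ν s t x = 1 := by
    filter_upwards [hgood] with s hs
    have hfc : Continuous (f s) := by
      rw [hfeq]
      have := hψc.comp (continuous_const_smul (ψinv d ν (1 / s)))
      simp only [Function.comp_def] at this
      fun_prop
    exact ⟨fun x => mul_nonneg (by positivity) (hfpos s hs.1 hs.2 x),
      integrable_and_integral_normalized_cosTransform (hfint s hs.1 hs.2) hfc
        (fun ξ => by simp only [ψs, smul_neg, hψneg]) (by simp [ψs, ψ_zero])
        (hfpos s hs.1 hs.2)⟩
  have hmain : Tendsto (fun s => ∫ x, |pts d ν s t x - ptα d α t x|) atTop (𝓝 0) :=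
    tendsto_integral_abs_sub_of_integral_eq (hp.mono fun s hs => hs.1)
      (hp.mono fun s hs => hs.2.1) hqint' (hp.mono fun s hs => hs.2.2.trans hq1.symm)
      fun x => (hlim x).const_mul _
  refine ⟨hmain, fun A _ => ?_⟩
  refine tendsto_iff_dist_tendsto_zero.2 (squeeze_zero' (Eventually.of_forall fun _ =>
    dist_nonneg) ?_ hmain)
  filter_upwards [hp] with s hs
  have hsub : Integrable fun x => pts d ν s t x - ptα d α t x := hs.2.1.sub hqint'
  rw [Real.dist_eq, ← integral_sub hs.2.1.integrableOn hqint'.integrableOn]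
  exact abs_integral_le_integral_abs.trans
    (setIntegral_le_integral hsub.abs (Eventually.of_forall fun _ => abs_nonneg _))

end
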